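/- arXiv:1503.04161 — 2 statements merged into one kernel-verified Lean document; each statement's English description precedes it below -/
import Mathlib

section
/- Let (X_n)_{n∈ℤ} be strictly stationary and near epoch dependent in probability (PNED) on (Z_n)_{n∈ℤ} with approximation constants a_l and non-increasing function φ, and let g be a bounded symmetric kernel satisfying the variation condition (Assumption 6). If there is a sequence of positive numbers (s_l)_{l∈ℕ} such that a_l φ(s_l) = O(s_l), then the sequence (g₁(X_n))_{n∈ℤ} is L₂-near epoch dependent on (Z_n)_{n∈ℤ} with approximation constants a_{l,2} = O(s_l^{1/2}); that is, there is C with ‖g₁(X_0) − E(g₁(X_0) | σ(Z_{−l},…,Z_l))‖_{L²} ≤ C·s_l^{1/2} for all l. -/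
open MeasureTheory Filter Set
open scoped ENNReal NNReal Topology BigOperators

noncomputable section

namespace UQuantile

variable {Ω : Type*} [MeasurableSpace Ω]

/-- Strict stationarity of the pair process `((X_i, Z_i))_{i ∈ ℤ}`. -/
def IsPairStationary (P : Measure Ω) (X Z : ℤ → Ω → ℝ) : Prop :=
  ∀ (k : ℤ) (n : ℕ) (idx : Fin n → ℤ),
    P.map (fun ω i => (X (idx i) ω, Z (idx i) ω)) =
      P.map (fun ω i => (X (idx i + k) ω, Z (idx i + k) ω))

/-- Near epoch dependence in probability (PNED) of `X` on `Z` with approximation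
constants `a` and gauge function `φ`. -/
def PNED (P : Measure Ω) (X Z : ℤ → Ω → ℝ) (a : ℕ → ℝ) (φ : ℝ → ℝ) : Prop :=
  ∃ f : (l : ℕ) → ((Fin (2 * l + 1) → ℝ) → ℝ),
    (∀ l, Measurable (f l)) ∧
      ∀ (l : ℕ), ∀ ε > (0 : ℝ),
        (P {ω | ε < |X 0 ω - f l fun i => Z (((i : ℕ) : ℤ) - (l : ℤ)) ω|}).toReal ≤ a l * φ ε

/-- The σ-field generated by `..., Z_{-1}, Z_0`. -/
def pastSigma (Z : ℤ → Ω → ℝ) : MeasurableSpace Ω :=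
  ⨆ i : {i : ℤ // i ≤ 0}, MeasurableSpace.comap (Z i) Real.measurableSpace

/-- The σ-field generated by `Z_k, Z_{k+1}, ...`. -/
def futureSigma (Z : ℤ → Ω → ℝ) (k : ℕ) : MeasurableSpace Ω :=
  ⨆ i : {i : ℤ // (k : ℤ) ≤ i}, MeasurableSpace.comap (Z i) Real.measurableSpace

/-- The σ-field generated by `Z_{-l}, ..., Z_l`. -/
def rangeSigma (Z : ℤ → Ω → ℝ) (l : ℕ) : MeasurableSpace Ω :=
  ⨆ i : {i : ℤ // -(l : ℤ) ≤ i ∧ i ≤ l}, MeasurableSpace.comap (Z i) Real.measurableSpace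

/-- `β` bounds the absolute regularity coefficients of `Z`: for every `k` and every pair of
finite measurable partitions of `Ω` into past, resp. future measurable sets,
`(1/2) Σ_{i,j} |P(A_i ∩ B_j) - P(A_i) P(B_j)| ≤ β k`. -/
def IsBetaBound (P : Measure Ω) (Z : ℤ → Ω → ℝ) (β : ℕ → ℝ) : Prop :=
  ∀ (k m m' : ℕ) (A : Fin m → Set Ω) (B : Fin m' → Set Ω),
    (∀ i, MeasurableSet[pastSigma Z] (A i)) →
    (∀ j, MeasurableSet[futureSigma Z k] (B j)) →
    Pairwise (Function.onFun Disjoint A) → Pairwise (Function.onFun Disjoint B) →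
    (⋃ i, A i) = univ → (⋃ j, B j) = univ →
    (1 / 2 : ℝ) * ∑ i, ∑ j,
        |(P (A i ∩ B j)).toReal - (P (A i)).toReal * (P (B j)).toReal| ≤ β k

/-- Assumption 1: `((X_i, Z_i))` is strictly stationary, `X` is PNED on `Z` with
`a_l φ(l^{-6}) = O(l^{-6})`, and `Z` is absolutely regular with `Σ k β_k < ∞`. -/
structure Assumption1 (P : Measure Ω) (X Z : ℤ → Ω → ℝ) : Prop where
  stationary : IsPairStationary P X Z
  pned : ∃ (a : ℕ → ℝ) (φ : ℝ → ℝ),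
    Tendsto a atTop (𝓝 0) ∧ AntitoneOn φ (Ioi 0) ∧ (∀ x > (0 : ℝ), 0 < φ x) ∧
      PNED P X Z a φ ∧
      (fun l : ℕ => a l * φ ((l : ℝ) ^ (-6 : ℤ))) =O[atTop] fun l : ℕ => (l : ℝ) ^ (-6 : ℤ)
  mixing : ∃ β : ℕ → ℝ, (∀ k, 0 ≤ β k) ∧ IsBetaBound P Z β ∧
      Summable fun k : ℕ => (k : ℝ) * β k

/-- A U-quantile kernel function: nonnegative, bounded, measurable, symmetric in the first
two arguments and non-decreasing in the third. -/
structure IsUQKernel (h : ℝ → ℝ → ℝ → ℝ) : Prop where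
  nonneg : ∀ x y t, 0 ≤ h x y t
  bounded : ∃ M, ∀ x y t, h x y t ≤ M
  measurable : Measurable fun q : ℝ × ℝ × ℝ => h q.1 q.2.1 q.2.2
  symm : ∀ x y t, h x y t = h y x t
  mono : ∀ x y, Monotone (h x y)

/-- The empirical U-distribution function `U_n(t)`. -/
def Ustat (X : ℤ → Ω → ℝ) (h : ℝ → ℝ → ℝ → ℝ) (n : ℕ) (t : ℝ) (ω : Ω) : ℝ :=
  (2 / ((n : ℝ) * ((n : ℝ) - 1))) *
    ∑ i ∈ Finset.Icc (1 : ℤ) (n : ℤ), ∑ j ∈ Finset.Ioc i (n : ℤ), h (X i ω) (X j ω) t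

/-- The population U-distribution function `U(t) = E h(X, Y, t)` for `X, Y` independent
with law `μ`. -/
def Udist (μ : Measure ℝ) (h : ℝ → ℝ → ℝ → ℝ) (t : ℝ) : ℝ := ∫ x, ∫ y, h x y t ∂μ ∂μ

/-- The linear part of the Hoeffding decomposition, `h₁(x, t) = E h(x, X₀, t) - U(t)`. -/
def h1 (μ : Measure ℝ) (h : ℝ → ℝ → ℝ → ℝ) (x t : ℝ) : ℝ := (∫ y, h x y t ∂μ) - Udist μ h t

/-- The degenerate part of the Hoeffding decomposition. -/
def h2 (μ : Measure ℝ) (h : ℝ → ℝ → ℝ → ℝ) (x y t : ℝ) : ℝ :=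
  h x y t - h1 μ h x t - h1 μ h y t - Udist μ h t

/-- The population `p`-U-quantile `U⁻¹(p)`. -/
def Uinv (μ : Measure ℝ) (h : ℝ → ℝ → ℝ → ℝ) (p : ℝ) : ℝ := sInf {t | p ≤ Udist μ h t}

/-- The empirical `p`-U-quantile `U_n⁻¹(p)`. -/
def UinvEmp (X : ℤ → Ω → ℝ) (h : ℝ → ℝ → ℝ → ℝ) (n : ℕ) (p : ℝ) (ω : Ω) : ℝ :=
  sInf {t | p ≤ Ustat X h n t ω}

/-- The variation condition for `h(·,·,t)` with constant `L`, with respect to the law `μ`. -/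
def VariationAt (μ : Measure ℝ) (h : ℝ → ℝ → ℝ → ℝ) (L t : ℝ) : Prop :=
  ∀ ε > (0 : ℝ),
    ∫⁻ q : ℝ × ℝ, ENNReal.ofReal
        ((⨆ r ∈ Metric.closedBall q ε, |h r.1 r.2 t - h q.1 q.2 t|) ^ 2) ∂(μ.prod μ)
      ≤ ENNReal.ofReal (L * ε)

/-- Assumption 2: the variation condition holds for all `t` in a neighborhood of `U⁻¹(p)`. -/
def Assumption2 (μ : Measure ℝ) (h : ℝ → ℝ → ℝ → ℝ) (p : ℝ) : Prop :=
  ∃ L δ : ℝ, 0 < δ ∧ ∀ t, |t - Uinv μ h p| < δ → VariationAt μ h L t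

/-- Assumption 3: `U` is differentiable near `U⁻¹(p)` with derivative `u`,
`u(U⁻¹(p)) > 0`, and a `3/2`-order Taylor-type expansion holds at `U⁻¹(p)`. -/
def Assumption3 (μ : Measure ℝ) (h : ℝ → ℝ → ℝ → ℝ) (p : ℝ) (u : ℝ → ℝ) : Prop :=
  (∀ᶠ t in 𝓝 (Uinv μ h p), HasDerivAt (Udist μ h) (u t) t) ∧
    0 < u (Uinv μ h p) ∧
    (fun t => Udist μ h t - p - u (Uinv μ h p) * (t - Uinv μ h p)) =o[𝓝 (Uinv μ h p)]
      fun t => |t - Uinv μ h p| ^ ((3 : ℝ) / 2)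

/-- The lag-`r` autocovariance `Cov(f(X_0), f(X_r))`. -/
def covShift (P : Measure Ω) (X : ℤ → Ω → ℝ) (f : ℝ → ℝ) (r : ℤ) : ℝ :=
  (∫ ω, f (X 0 ω) * f (X r ω) ∂P) - (∫ ω, f (X 0 ω) ∂P) * ∫ ω, f (X r ω) ∂P

/-- The long-run variance `σ_p²` of the `p`-U-quantile. -/
def lrv (P : Measure Ω) (X : ℤ → Ω → ℝ) (h : ℝ → ℝ → ℝ → ℝ) (p : ℝ) (u : ℝ → ℝ) : ℝ :=
  (4 / u (Uinv (P.map (X 0)) h p) ^ 2) *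
    ∑' r : ℤ, covShift P X (fun x => h1 (P.map (X 0)) h x (Uinv (P.map (X 0)) h p)) r

end UQuantile

open MeasureTheory Filter Set
open scoped ENNReal NNReal Topology BigOperators

noncomputable section
namespace UQuantile
variable {Ω : Type*} [MeasurableSpace Ω]

/-- The indicator kernel `h(x,y,t) = 1{g(x,y) ≤ t}`. -/
def hInd (g : ℝ → ℝ → ℝ) (x y t : ℝ) : ℝ := if g x y ≤ t then 1 else 0

/-- Kernel density estimator of the U-statistic density. -/
def uhat (X : ℤ → Ω → ℝ) (g : ℝ → ℝ → ℝ) (K : ℝ → ℝ) (d : ℕ → ℝ) (n : ℕ) (t : ℝ)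
    (ω : Ω) : ℝ :=
  (2 / ((n : ℝ) * ((n : ℝ) - 1) * d n)) *
    ∑ i ∈ Finset.Icc (1 : ℤ) (n : ℤ), ∑ j ∈ Finset.Ioc i (n : ℤ),
      K ((g (X i ω) (X j ω) - t) / d n)

/-- Empirical version `ĥ₁(x, t)` of `h₁(x, t)`. -/
def h1hat (X : ℤ → Ω → ℝ) (g : ℝ → ℝ → ℝ) (n : ℕ) (x t : ℝ) (ω : Ω) : ℝ :=
  ((n : ℝ)⁻¹ * ∑ i ∈ Finset.Icc (1 : ℤ) (n : ℤ), hInd g x (X i ω) t) -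
    ((n : ℝ)⁻¹ ^ 2 *
      ∑ i ∈ Finset.Icc (1 : ℤ) (n : ℤ), ∑ j ∈ Finset.Icc (1 : ℤ) (n : ℤ),
        hInd g (X i ω) (X j ω) t)

/-- Sample lag-`r` autocovariance `ρ̂(r, t)` of `(ĥ₁(X_i, t))_i`. -/
def rhohat (X : ℤ → Ω → ℝ) (g : ℝ → ℝ → ℝ) (n r : ℕ) (t : ℝ) (ω : Ω) : ℝ :=
  (n : ℝ)⁻¹ * ∑ i ∈ Finset.Icc (1 : ℤ) ((n : ℤ) - (r : ℤ)),
    h1hat X g n (X i ω) t ω * h1hat X g n (X (i + (r : ℤ)) ω) t ω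

/-- The HAC long-run variance estimator `σ̂²_{p,n}`. -/
def sigma2hat (X : ℤ → Ω → ℝ) (g : ℝ → ℝ → ℝ) (K W : ℝ → ℝ) (d b : ℕ → ℝ) (n : ℕ)
    (p : ℝ) (ω : Ω) : ℝ :=
  (4 / uhat X g K d n (UinvEmp X (hInd g) n p ω) ω ^ 2) *
    ∑ r ∈ Finset.Icc (-(n : ℤ) + 1) ((n : ℤ) - 1),
      W ((r.natAbs : ℝ) / b n) * rhohat X g n r.natAbs (UinvEmp X (hInd g) n p ω) ω

/-- Assumption 4: conditions on the density kernel `K` and the bandwidth `d_n`. -/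
structure Assumption4 (K : ℝ → ℝ) (d : ℕ → ℝ) : Prop where
  symm : ∀ x, K (-x) = K x
  lipschitz : ∃ c : ℝ≥0, LipschitzWith c K
  compact_support : HasCompactSupport K
  bounded_variation : BoundedVariationOn K univ
  integral_one : ∫ x, K x = 1
  d_pos : ∀ n, 0 < d n
  d_to_zero : Tendsto d atTop (𝓝 0)
  nd_to_top : Tendsto (fun n : ℕ => (n : ℝ) * d n ^ ((8 : ℝ) / 3)) atTop atTop

/-- Assumption 5: conditions on the HAC kernel `W` and the bandwidth `b_n`. -/
structure Assumption5 (W : ℝ → ℝ) (b : ℕ → ℝ) : Prop where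
  range : ∀ x ≥ (0 : ℝ), 0 ≤ W x ∧ W x < 1
  cont_zero : ContinuousWithinAt W (Ici 0) 0
  cont : ∃ S : Finset ℝ, ∀ x ≥ (0 : ℝ), x ∉ S → ContinuousWithinAt W (Ici 0) x
  dominated : ∃ Wb : ℝ → ℝ, AntitoneOn Wb (Ici 0) ∧ IntegrableOn Wb (Ici 0) ∧
      ∀ x ≥ (0 : ℝ), |W x| ≤ Wb x
  fourier : IntegrableOn (fun x => |∫ t in Ioi (0 : ℝ), W t * Real.cos (x * t)|) (Ioi 0)
  b_pos : ∀ n, 0 < b n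
  b_top : Tendsto b atTop atTop
  b_sqrt : Tendsto (fun n : ℕ => b n / Real.sqrt n) atTop (𝓝 0)

/-- Assumption 6: the variation condition for the kernel `g`. -/
def Assumption6 (μ : Measure ℝ) (g : ℝ → ℝ → ℝ) : Prop :=
  ∃ L : ℝ, ∀ ε > (0 : ℝ),
    ∫⁻ q : ℝ × ℝ, ENNReal.ofReal
        ((⨆ r ∈ Metric.closedBall q ε, |g r.1 r.2 - g q.1 q.2|) ^ 2) ∂(μ.prod μ)
      ≤ ENNReal.ofReal (L * ε)

end UQuantile

namespace UQuantile

/-- `g₁(x) = E g(x, Y) - E g(X, Y)` for `X, Y` independent with law `μ`. -/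
def g1 (μ : Measure ℝ) (g : ℝ → ℝ → ℝ) (x : ℝ) : ℝ :=
  (∫ y, g x y ∂μ) - ∫ x', ∫ y, g x' y ∂μ ∂μ

/-- Jensen: the squared increment of `g₁` is bounded by the averaged squared increment of `g`. -/
lemma aux_jensen (μ : Measure ℝ) [IsProbabilityMeasure μ] (g : ℝ → ℝ → ℝ) (M : ℝ)
    (hM : ∀ x y, |g x y| ≤ M) (hg_meas : Measurable fun q : ℝ × ℝ => g q.1 q.2) (x w : ℝ) :
    ENNReal.ofReal ((g1 μ g x - g1 μ g w) ^ 2) ≤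
      ∫⁻ y, ENNReal.ofReal ((g x y - g w y) ^ 2) ∂μ := by
  have hm : ∀ x, Measurable (g x) := fun x => hg_meas.comp measurable_prodMk_left
  have hi : ∀ x, Integrable (g x) μ := fun x =>
    Integrable.of_bound (hm x).aestronglyMeasurable M (ae_of_all _ fun y => by
      simpa [Real.norm_eq_abs] using hM x y)
  have hd : Integrable (fun y => g x y - g w y) μ := (hi x).sub (hi w)
  have hb : ∀ y, |g x y - g w y| ≤ 2 * M := fun y => by
    have h1 := abs_le.1 (hM x y)
    have h2 := abs_le.1 (hM w y)
    exact abs_le.2 ⟨by linarith, by linarith⟩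
  have hd2 : Integrable (fun y => (g x y - g w y) ^ 2) μ :=
    Integrable.of_bound (((hm x).sub (hm w)).pow_const 2).aestronglyMeasurable ((2 * M) ^ 2)
      (ae_of_all _ fun y => by
        rw [Real.norm_eq_abs, abs_pow]
        exact pow_le_pow_left₀ (abs_nonneg _) (hb y) 2)
  have he : g1 μ g x - g1 μ g w = ∫ y, (g x y - g w y) ∂μ := by
    rw [integral_sub (hi x) (hi w)]
    unfold g1
    ring
  have hj : (∫ y, (g x y - g w y) ∂μ) ^ 2 ≤ ∫ y, (g x y - g w y) ^ 2 ∂μ := by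
    have := ConvexOn.map_integral_le (μ := μ) (s := univ) (g := fun t : ℝ => t ^ 2)
      (f := fun y => g x y - g w y) (even_two.convexOn_pow) (by fun_prop) isClosed_univ
      (by simp) hd hd2
    simpa using this
  rw [he, ← ofReal_integral_eq_lintegral_ofReal hd2 (ae_of_all _ fun y => sq_nonneg _)]
  exact ENNReal.ofReal_le_ofReal hj

lemma aux_core {Ω : Type*} [MeasurableSpace Ω] (P : Measure Ω) [IsProbabilityMeasure P]
    (X W : Ω → ℝ) (hX : Measurable X) (hW : Measurable W)
    (g : ℝ → ℝ → ℝ) (M : ℝ) (hM : ∀ x y, |g x y| ≤ M)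
    (hg_meas : Measurable fun q : ℝ × ℝ => g q.1 q.2) (t B : ℝ)
    (hvar : ∫⁻ q : ℝ × ℝ, ENNReal.ofReal
        ((⨆ r ∈ Metric.closedBall q t, |g r.1 r.2 - g q.1 q.2|) ^ 2) ∂((P.map X).prod (P.map X))
      ≤ ENNReal.ofReal B) :
    ∫⁻ ω, ENNReal.ofReal ((g1 (P.map X) g (X ω) - g1 (P.map X) g (W ω)) ^ 2) ∂P ≤
      ENNReal.ofReal B + ENNReal.ofReal (4 * M ^ 2) * P {ω | t < |X ω - W ω|} := by
  set μ := P.map X with hμ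
  have : IsProbabilityMeasure μ := Measure.isProbabilityMeasure_map hX.aemeasurable
  set κ := ProbabilityTheory.condDistrib W X P with hκ
  have hb : ∀ x w y, |g x y - g w y| ≤ 2 * M := fun x w y => by
    have h1 := abs_le.1 (hM x y)
    have h2 := abs_le.1 (hM w y)
    exact abs_le.2 ⟨by linarith, by linarith⟩
  -- truncated kernel
  let k : (ℝ × ℝ) × ℝ → ℝ≥0∞ := fun q =>
    {q : (ℝ × ℝ) × ℝ | |q.1.1 - q.1.2| ≤ t}.indicator
      (fun q => ENNReal.ofReal ((g q.1.1 q.2 - g q.1.2 q.2) ^ 2)) q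
  have hk : Measurable k := by
    refine Measurable.indicator ?_ ?_
    · have h1 : Measurable fun q : (ℝ × ℝ) × ℝ => g q.1.1 q.2 :=
        hg_meas.comp (by fun_prop : Measurable fun q : (ℝ × ℝ) × ℝ => (q.1.1, q.2))
      have h2 : Measurable fun q : (ℝ × ℝ) × ℝ => g q.1.2 q.2 :=
        hg_meas.comp (by fun_prop : Measurable fun q : (ℝ × ℝ) × ℝ => (q.1.2, q.2))
      exact ((h1.sub h2).pow_const 2).ennreal_ofReal
    · exact measurableSet_le (by fun_prop) measurable_const
  let F : ℝ × ℝ → ℝ≥0∞ := fun p => ∫⁻ y, k (p, y) ∂μ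
  have hF : Measurable F := hk.lintegral_prod_right'
  have hset : MeasurableSet {ω | t < |X ω - W ω|} :=
    measurableSet_lt measurable_const (by fun_prop)
  have hpt : ∀ ω, ENNReal.ofReal ((g1 μ g (X ω) - g1 μ g (W ω)) ^ 2) ≤
      F (X ω, W ω) + {ω | t < |X ω - W ω|}.indicator (fun _ => ENNReal.ofReal (4 * M ^ 2)) ω := by
    intro ω
    refine (aux_jensen μ g M hM hg_meas _ _).trans ?_
    by_cases h : t < |X ω - W ω|
    · rw [indicator_of_mem (by exact h)]
      refine le_add_left ?_
      calc _ ≤ ∫⁻ _, ENNReal.ofReal (4 * M ^ 2) ∂μ := by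
            refine lintegral_mono fun y => ENNReal.ofReal_le_ofReal ?_
            have := sq_le_sq' (by linarith [abs_le.1 (hb (X ω) (W ω) y)])
              (abs_le.1 (hb (X ω) (W ω) y)).2
            linarith
        _ = _ := by simp
    · refine le_add_right (lintegral_mono fun y => ?_)
      have : ((X ω, W ω), y) ∈ {q : (ℝ × ℝ) × ℝ | |q.1.1 - q.1.2| ≤ t} := not_lt.1 h
      simp only [k]
      rw [indicator_of_mem this]
  have hdis : ∫⁻ ω, F (X ω, W ω) ∂P ≤ ENNReal.ofReal B := by
    refine le_trans ?_ hvar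
    let H : ℝ × ℝ → ℝ≥0∞ := fun q => ∫⁻ w, k ((q.1, w), q.2) ∂(κ q.1)
    have hH : Measurable H := by
      have := Measurable.lintegral_kernel_prod_right'
        (κ := κ.comap (Prod.fst : ℝ × ℝ → ℝ) measurable_fst)
        (f := fun z : (ℝ × ℝ) × ℝ => k ((z.1.1, z.2), z.1.2)) (hk.comp (by fun_prop))
      simpa [ProbabilityTheory.Kernel.comap_apply] using this
    calc ∫⁻ ω, F (X ω, W ω) ∂P = ∫⁻ p, F p ∂(P.map fun ω => (X ω, W ω)) :=
          (lintegral_map hF (hX.prodMk hW)).symm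
      _ = ∫⁻ p, F p ∂(μ.compProd κ) := by
          rw [ProbabilityTheory.compProd_map_condDistrib hW.aemeasurable]
      _ = ∫⁻ x, ∫⁻ w, F (x, w) ∂(κ x) ∂μ := Measure.lintegral_compProd hF
      _ = ∫⁻ x, ∫⁻ y, H (x, y) ∂μ ∂μ := by
          refine lintegral_congr fun x => ?_
          exact lintegral_lintegral_swap (hk.comp (by fun_prop :
            Measurable fun z : ℝ × ℝ => ((x, z.1), z.2))).aemeasurable
      _ = ∫⁻ q, H q ∂(μ.prod μ) := (lintegral_prod _ hH.aemeasurable).symm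
      _ ≤ _ := by
          refine lintegral_mono fun q => ?_
          obtain ⟨x, y⟩ := q
          set S := ENNReal.ofReal
            ((⨆ r ∈ Metric.closedBall (x, y) t, |g r.1 r.2 - g x y|) ^ 2) with hS
          calc H (x, y) ≤ ∫⁻ _, S ∂(κ x) := by
                refine lintegral_mono fun w => ?_
                by_cases h : |x - w| ≤ t
                · have hmem : ((x, w), y) ∈ {q : (ℝ × ℝ) × ℝ | |q.1.1 - q.1.2| ≤ t} := h
                  simp only [k]
                  rw [indicator_of_mem hmem]
                  refine ENNReal.ofReal_le_ofReal ?_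
                  rw [← sq_abs (g x y - g w y), abs_sub_comm]
                  refine pow_le_pow_left₀ (abs_nonneg _) ?_ 2
                  have hM0 : 0 ≤ 2 * M := (abs_nonneg _).trans (hb 0 0 0)
                  have hb2 : ∀ r : ℝ × ℝ, |g r.1 r.2 - g x y| ≤ 2 * M := fun r => by
                    have h1 := abs_le.1 (hM r.1 r.2)
                    have h2 := abs_le.1 (hM x y)
                    exact abs_le.2 ⟨by linarith, by linarith⟩
                  have hball : (w, y) ∈ Metric.closedBall (x, y) t := by
                    have ht : 0 ≤ t := (abs_nonneg _).trans h
                    rw [Metric.mem_closedBall, Prod.dist_eq]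
                    simpa [Real.dist_eq, abs_sub_comm w x, ht] using h
                  have hbdd : BddAbove (range fun r : ℝ × ℝ =>
                      ⨆ (_ : r ∈ Metric.closedBall (x, y) t), |g r.1 r.2 - g x y|) := by
                    refine ⟨2 * M, ?_⟩
                    rintro _ ⟨r, rfl⟩
                    exact Real.iSup_le (fun _ => hb2 r) hM0
                  refine le_trans ?_ (le_ciSup hbdd (w, y))
                  simp only [hball, ciSup_unique, le_refl]
                · have hmem : ((x, w), y) ∉ {q : (ℝ × ℝ) × ℝ | |q.1.1 - q.1.2| ≤ t} := h
                  simp only [k]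
                  rw [indicator_of_notMem hmem]
                  exact zero_le
            _ = S := by simp
  calc _ ≤ ∫⁻ ω, (F (X ω, W ω) +
        {ω | t < |X ω - W ω|}.indicator (fun _ => ENNReal.ofReal (4 * M ^ 2)) ω) ∂P :=
        lintegral_mono hpt
    _ = ∫⁻ ω, F (X ω, W ω) ∂P + ENNReal.ofReal (4 * M ^ 2) * P {ω | t < |X ω - W ω|} := by
        rw [lintegral_add_left (by exact hF.comp (hX.prodMk hW)), lintegral_indicator_const hset]
    _ ≤ _ := by gcongr

/-- (Lemma A.2.) If `(X_n)` is PNED on `(Z_n)` with constants `a_l` and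
gauge `φ`, `g` is a bounded symmetric kernel satisfying the variation condition, and
`a_l φ(s_l) = O(s_l)` for positive `s_l`, then `(g₁(X_n))` is `L₂`-NED on `(Z_n)` with
approximation constants `O(√s_l)`. -/
theorem l2ned_of_pned
    {Ω : Type*} [MeasurableSpace Ω] (P : Measure Ω) [IsProbabilityMeasure P]
    (X Z : ℤ → Ω → ℝ) (hX : ∀ i, Measurable (X i)) (hZ : ∀ i, Measurable (Z i))
    (hstat : IsPairStationary P X Z)
    (a : ℕ → ℝ) (φ : ℝ → ℝ) (ha : Tendsto a atTop (𝓝 0))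
    (hφ_anti : AntitoneOn φ (Set.Ioi 0)) (hφ_pos : ∀ x > (0 : ℝ), 0 < φ x)
    (hpned : PNED P X Z a φ)
    (g : ℝ → ℝ → ℝ) (hg_bdd : ∃ M : ℝ, ∀ x y, |g x y| ≤ M)
    (hg_symm : ∀ x y, g x y = g y x)
    (hg_meas : Measurable fun q : ℝ × ℝ => g q.1 q.2)
    (hg_var : Assumption6 (P.map (X 0)) g)
    (s : ℕ → ℝ) (hs_pos : ∀ l, 0 < s l)
    (hOs : (fun l => a l * φ (s l)) =O[atTop] s) :
    ∃ C : ℝ, ∀ l : ℕ,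
      eLpNorm (fun ω =>
          g1 (P.map (X 0)) g (X 0 ω)
            - (P[(fun ω' => g1 (P.map (X 0)) g (X 0 ω')) | rangeSigma Z l]) ω) 2 P ≤
        ENNReal.ofReal (C * Real.sqrt (s l)) := by
  obtain ⟨f, hf, hp⟩ := hpned
  obtain ⟨M, hM⟩ := hg_bdd
  obtain ⟨L, hL⟩ := hg_var
  obtain ⟨c, hc, hbound⟩ := Asymptotics.bound_of_isBigO_nat_atTop hOs
  set μ := P.map (X 0) with hμ
  have : IsProbabilityMeasure μ := Measure.isProbabilityMeasure_map (hX 0).aemeasurable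
  set D : ℝ := |L| + 4 * M ^ 2 * c with hD
  have hD0 : 0 ≤ D := by positivity
  refine ⟨2 * Real.sqrt D, fun l => ?_⟩
  have hsl := hs_pos l
  set W : Ω → ℝ := fun ω => f l fun i => Z (((i : ℕ) : ℤ) - (l : ℤ)) ω with hWdef
  have hle : rangeSigma Z l ≤ ‹MeasurableSpace Ω› :=
    iSup_le fun i => (hZ i).comap_le
  have hWm : Measurable[rangeSigma Z l] W := by
    have hpi : Measurable[rangeSigma Z l]
        (fun ω (i : Fin (2 * l + 1)) => Z (((i : ℕ) : ℤ) - (l : ℤ)) ω) := ?_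
    · exact (hf l).comp hpi
    refine (@measurable_pi_iff _ _ _ (rangeSigma Z l) _ _).2 fun i => ?_
    have hi : -(l : ℤ) ≤ ((i : ℕ) : ℤ) - (l : ℤ) ∧ ((i : ℕ) : ℤ) - (l : ℤ) ≤ l := by
      have := i.2
      omega
    refine Measurable.mono (comap_measurable (Z (((i : ℕ) : ℤ) - (l : ℤ)))) ?_ le_rfl
    exact le_iSup (fun j : {i : ℤ // -(l : ℤ) ≤ i ∧ i ≤ l} =>
      MeasurableSpace.comap (Z j) Real.measurableSpace) ⟨_, hi⟩
  have hW : Measurable W := hWm.mono hle le_rfl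
  have hprob : P {ω | s l < |X 0 ω - W ω|} ≤ ENNReal.ofReal (c * s l) := by
    rw [← ENNReal.ofReal_toReal (measure_ne_top P {ω | s l < |X 0 ω - W ω|})]
    refine ENNReal.ofReal_le_ofReal ((hp l (s l) hsl).trans ?_)
    have := hbound (x := l) hsl.ne'
    rw [Real.norm_eq_abs, Real.norm_eq_abs, abs_of_pos hsl] at this
    exact (le_abs_self _).trans this
  have hcore := aux_core P (X 0) W (hX 0) hW g M hM hg_meas (s l) (L * s l) (hL _ hsl)
  have hsq : ∫⁻ ω, ENNReal.ofReal ((g1 μ g (X 0 ω) - g1 μ g (W ω)) ^ 2) ∂P ≤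
      ENNReal.ofReal (D * s l) := by
    refine hcore.trans ?_
    calc _ ≤ ENNReal.ofReal (|L| * s l) + ENNReal.ofReal (4 * M ^ 2) * ENNReal.ofReal (c * s l) := by
          gcongr
          exact le_abs_self L
      _ = _ := by
          rw [← ENNReal.ofReal_mul (by positivity), ← ENNReal.ofReal_add (by positivity)
            (by positivity), hD]
          congr 1
          ring
  -- regularity of g₁
  have hg1m : Measurable (g1 μ g) :=
    (hg_meas.stronglyMeasurable.integral_prod_right).measurable.sub_const _
  have hg1b : ∃ K, ∀ x, |g1 μ g x| ≤ K := by
    refine ⟨M + |∫ x', ∫ y, g x' y ∂μ ∂μ|, fun x => ?_⟩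
    refine (abs_sub _ _).trans (add_le_add ?_ le_rfl)
    have := norm_integral_le_of_norm_le_const (μ := μ) (f := g x) (C := M)
      (ae_of_all _ fun y => by simpa [Real.norm_eq_abs] using hM x y)
    simpa using this
  obtain ⟨K, hK⟩ := hg1b
  have hint : ∀ V : Ω → ℝ, Measurable V → Integrable (fun ω => g1 μ g (V ω)) P := fun V hV =>
    Integrable.of_bound (hg1m.comp hV).aestronglyMeasurable K (ae_of_all _ fun y => by
      simpa [Real.norm_eq_abs] using hK _)
  have hYi := hint _ (hX 0)
  have hVi := hint _ hW
  set Y : Ω → ℝ := fun ω => g1 μ g (X 0 ω) with hY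
  set V : Ω → ℝ := fun ω => g1 μ g (W ω) with hV
  have hVm : StronglyMeasurable[rangeSigma Z l] V := (hg1m.comp hWm).stronglyMeasurable
  have hnorm : eLpNorm (Y - V) 2 P ≤ ENNReal.ofReal (Real.sqrt D * Real.sqrt (s l)) := by
    rw [eLpNorm_eq_lintegral_rpow_enorm_toReal (by norm_num) (by norm_num)]
    rw [← Real.sqrt_mul hD0, Real.sqrt_eq_rpow, ← ENNReal.ofReal_rpow_of_nonneg (by positivity)
      (by norm_num)]
    simp only [ENNReal.toReal_ofNat]
    refine ENNReal.rpow_le_rpow (le_trans (le_of_eq ?_) hsq) (by norm_num)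
    refine lintegral_congr fun ω => ?_
    rw [Real.enorm_eq_ofReal_abs, ENNReal.ofReal_rpow_of_nonneg (abs_nonneg _) (by norm_num)]
    congr 1
    rw [← sq_abs]
    exact Real.rpow_natCast _ 2
  have hce : (fun ω => Y ω - (P[Y | rangeSigma Z l]) ω) =ᵐ[P]
      (Y - V) - P[Y - V | rangeSigma Z l] := by
    have h1 := condExp_sub hYi hVi (rangeSigma Z l)
    have h2 : P[V | rangeSigma Z l] = V := condExp_of_stronglyMeasurable hle hVm hVi
    filter_upwards [h1] with ω hω
    simp only [Pi.sub_apply] at hω ⊢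
    rw [hω, h2]
    ring
  calc eLpNorm (fun ω => Y ω - (P[Y | rangeSigma Z l]) ω) 2 P
      = eLpNorm ((Y - V) - P[Y - V | rangeSigma Z l]) 2 P := eLpNorm_congr_ae hce
    _ ≤ eLpNorm (Y - V) 2 P + eLpNorm (P[Y - V | rangeSigma Z l]) 2 P :=
        eLpNorm_sub_le (hYi.sub hVi).aestronglyMeasurable
          integrable_condExp.aestronglyMeasurable (by norm_num)
    _ ≤ eLpNorm (Y - V) 2 P + eLpNorm (Y - V) 2 P := by
        gcongr
        exact eLpNorm_condExp_le_eLpNorm _ (by norm_num)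
    _ ≤ ENNReal.ofReal (Real.sqrt D * Real.sqrt (s l)) +
        ENNReal.ofReal (Real.sqrt D * Real.sqrt (s l)) := add_le_add hnorm hnorm
    _ = _ := by
        rw [← ENNReal.ofReal_add (by positivity) (by positivity)]
        congr 1
        ring

end UQuantile
end
end
end

section
/- Under Assumption 1, for any t ∈ ℝ at which the variation condition of Assumption 2 holds for the U-quantile kernel h, there is a constant C such that for all k ∈ ℕ, ‖max_{n≤2^k} |Σ_{1≤i<j≤n} h₂(X_i,X_j,t)|‖_{L²} ≤ C·2^{5k/4}·k, where h₂ is the degenerate part of the Hoeffding decomposition of h(·,·,t). -/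
open MeasureTheory Filter Set
open scoped ENNReal NNReal Topology BigOperators

noncomputable section

namespace UQuantile

/-- Sets of the form `{(x, y) | (f x, g y) ∈ T}` with finitely valued measurable `f`, `g`. -/
def gridSets (E F : Type*) [MeasurableSpace E] [MeasurableSpace F] : Set (Set (E × F)) :=
  {S | ∃ (m m' : ℕ) (f : E → Fin m) (g : F → Fin m') (T : Set (Fin m × Fin m')),
    Measurable f ∧ Measurable g ∧ S = (fun p : E × F => (f p.1, g p.2)) ⁻¹' T}

lemma gridSets_isSetAlgebra (E F : Type*) [MeasurableSpace E] [MeasurableSpace F] :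
    IsSetAlgebra (gridSets E F) where
  empty_mem := ⟨1, 1, fun _ => 0, fun _ => 0, ∅, measurable_const, measurable_const, by simp⟩
  compl_mem := by
    rintro s ⟨m, m', f, g, T, hf, hg, rfl⟩
    exact ⟨m, m', f, g, Tᶜ, hf, hg, rfl⟩
  union_mem := by
    rintro s t ⟨m, m', f, g, T, hf, hg, rfl⟩ ⟨n, n', f', g', T', hf', hg', rfl⟩
    refine ⟨m * n, m' * n', fun x => finProdFinEquiv (f x, f' x),
      fun y => finProdFinEquiv (g y, g' y),
      {q | ((finProdFinEquiv.symm q.1).1, (finProdFinEquiv.symm q.2).1) ∈ T ∨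
        ((finProdFinEquiv.symm q.1).2, (finProdFinEquiv.symm q.2).2) ∈ T'}, ?_, ?_, ?_⟩
    · exact (measurable_of_finite _).comp (hf.prodMk hf')
    · exact (measurable_of_finite _).comp (hg.prodMk hg')
    · ext p
      simp only [mem_union, mem_preimage, mem_ofPred_eq, Equiv.symm_apply_apply]

lemma gridSets_generate (E F : Type*) [MeasurableSpace E] [MeasurableSpace F] :
    (inferInstance : MeasurableSpace (E × F)) = MeasurableSpace.generateFrom (gridSets E F) := by
  apply le_antisymm
  · rw [← generateFrom_prod (α := E) (β := F)]
    apply MeasurableSpace.generateFrom_mono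
    rintro _ ⟨s, hs, t, ht, rfl⟩
    classical
    refine ⟨2, 2, fun x => if x ∈ s then 0 else 1, fun x => if x ∈ t then 0 else 1, {(0, 0)},
      Measurable.ite hs measurable_const measurable_const,
      Measurable.ite ht measurable_const measurable_const, ?_⟩
    ext p
    simp only [mem_prod, mem_preimage, mem_singleton_iff, Prod.mk.injEq]
    by_cases h1 : p.1 ∈ s <;> by_cases h2 : p.2 ∈ t <;> simp [h1, h2]
  · apply MeasurableSpace.generateFrom_le
    rintro _ ⟨m, m', f, g, T, hf, hg, rfl⟩
    exact ((hf.comp measurable_fst).prodMk (hg.comp measurable_snd)) (Set.toFinite T).measurableSet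

lemma past_le {Ω : Type*} [mΩ : MeasurableSpace Ω] {Z : ℤ → Ω → ℝ} (hZ : ∀ i, Measurable (Z i)) :
    pastSigma Z ≤ mΩ := iSup_le fun i => (hZ i).comap_le

lemma future_le {Ω : Type*} [mΩ : MeasurableSpace Ω] {Z : ℤ → Ω → ℝ}
    (hZ : ∀ i, Measurable (Z i)) (k : ℕ) :
    futureSigma Z k ≤ mΩ := iSup_le fun i => (hZ i).comap_le

/-- total variation bound on grid sets -/
lemma tv_grid {Ω E F : Type*} [MeasurableSpace Ω] [MeasurableSpace E] [MeasurableSpace F]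
    (P : Measure Ω) [IsProbabilityMeasure P] {Z : ℤ → Ω → ℝ} (hZ : ∀ i, Measurable (Z i))
    {β : ℕ → ℝ} (hβ : IsBetaBound P Z β) (k : ℕ) {Y : Ω → E} {W : Ω → F}
    (hY : Measurable[pastSigma Z] Y) (hW : Measurable[futureSigma Z k] W)
    (S : Set (E × F)) (hS : S ∈ gridSets E F) :
    |(P.map fun ω => (Y ω, W ω)).real S - ((P.map Y).prod (P.map W)).real S| ≤ 2 * β k := by
  have hY' : Measurable Y := hY.mono (past_le hZ) le_rfl
  have hW' : Measurable W := hW.mono (future_le hZ k) le_rfl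
  have : IsProbabilityMeasure (P.map Y) := Measure.isProbabilityMeasure_map hY'.aemeasurable
  have : IsProbabilityMeasure (P.map W) := Measure.isProbabilityMeasure_map hW'.aemeasurable
  have : IsProbabilityMeasure (P.map fun ω => (Y ω, W ω)) :=
    Measure.isProbabilityMeasure_map (hY'.prodMk hW').aemeasurable
  obtain ⟨m, m', f, g, T, hf, hg, rfl⟩ := hS
  classical
  have key := hβ k m m' (fun i => Y ⁻¹' (f ⁻¹' {i})) (fun j => W ⁻¹' (g ⁻¹' {j}))
    (fun i => hY (hf (measurableSet_singleton i))) (fun j => hW (hg (measurableSet_singleton j)))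
    (by
      intro i j hij
      refine Set.disjoint_left.2 fun ω h1 h2 => hij ?_
      simp only [mem_preimage, mem_singleton_iff] at h1 h2
      rw [← h1, h2])
    (by
      intro i j hij
      refine Set.disjoint_left.2 fun ω h1 h2 => hij ?_
      simp only [mem_preimage, mem_singleton_iff] at h1 h2
      rw [← h1, h2])
    (by ext ω; simp) (by ext ω; simp)
  have dec : ∀ (ρ : Measure (E × F)) [IsProbabilityMeasure ρ],
      ρ.real ((fun p : E × F => (f p.1, g p.2)) ⁻¹' T) =
      ∑ i, ∑ j, if (i, j) ∈ T then ρ.real ((f ⁻¹' {i}) ×ˢ (g ⁻¹' {j})) else 0 := by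
    intro ρ _
    have e : (fun p : E × F => (f p.1, g p.2)) ⁻¹' T =
        ⋃ q ∈ T.toFinset, (f ⁻¹' {q.1}) ×ˢ (g ⁻¹' {q.2}) := by
      ext p
      simp
    rw [e, measureReal_biUnion_finset]
    · rw [← Fintype.sum_prod_type' (fun i j => if (i, j) ∈ T then
        ρ.real ((f ⁻¹' {i}) ×ˢ (g ⁻¹' {j})) else 0), ← Finset.sum_filter]
      apply Finset.sum_congr _ (fun _ _ => rfl)
      ext q; simp
    · intro a _ b _ hab
      refine Set.disjoint_left.2 fun p h1 h2 => hab ?_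
      simp only [mem_prod, mem_preimage, mem_singleton_iff] at h1 h2
      ext
      · rw [← h1.1, h2.1]
      · rw [← h1.2, h2.2]
    · intro q _
      exact (hf (measurableSet_singleton _)).prod (hg (measurableSet_singleton _))
  rw [dec, dec]
  simp only [← Finset.sum_sub_distrib]
  have : ∑ i, ∑ j, |(P (Y ⁻¹' (f ⁻¹' {i}) ∩ W ⁻¹' (g ⁻¹' {j}))).toReal -
      (P (Y ⁻¹' (f ⁻¹' {i}))).toReal * (P (W ⁻¹' (g ⁻¹' {j}))).toReal| ≤ 2 * β k := by linarith
  refine le_trans ((Finset.abs_sum_le_sum_abs _ _).trans (Finset.sum_le_sum fun i _ =>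
    (Finset.abs_sum_le_sum_abs _ _).trans (Finset.sum_le_sum fun j _ => ?_))) this
  split_ifs
  · apply le_of_eq
    congr 2
    · rw [measureReal_def, Measure.map_apply (hY'.prodMk hW')
        ((hf (measurableSet_singleton _)).prod (hg (measurableSet_singleton _)))]
      rfl
    · rw [measureReal_prod_prod, measureReal_def, measureReal_def,
        Measure.map_apply hY' (hf (measurableSet_singleton _)),
        Measure.map_apply hW' (hg (measurableSet_singleton _))]
  · simp

lemma tv_set {Ω E F : Type*} [MeasurableSpace Ω] [MeasurableSpace E] [MeasurableSpace F]
    (P : Measure Ω) [IsProbabilityMeasure P] {Z : ℤ → Ω → ℝ} (hZ : ∀ i, Measurable (Z i))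
    {β : ℕ → ℝ} (hβ : IsBetaBound P Z β) (k : ℕ) {Y : Ω → E} {W : Ω → F}
    (hY : Measurable[pastSigma Z] Y) (hW : Measurable[futureSigma Z k] W)
    (S : Set (E × F)) (hS : MeasurableSet S) :
    |(P.map fun ω => (Y ω, W ω)).real S - ((P.map Y).prod (P.map W)).real S| ≤ 2 * β k := by
  have hY' : Measurable Y := hY.mono (past_le hZ) le_rfl
  have hW' : Measurable W := hW.mono (future_le hZ k) le_rfl
  have : IsProbabilityMeasure (P.map Y) := Measure.isProbabilityMeasure_map hY'.aemeasurable
  have : IsProbabilityMeasure (P.map W) := Measure.isProbabilityMeasure_map hW'.aemeasurable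
  have : IsProbabilityMeasure (P.map fun ω => (Y ω, W ω)) :=
    Measure.isProbabilityMeasure_map (hY'.prodMk hW').aemeasurable
  set J := P.map fun ω => (Y ω, W ω)
  set Q := (P.map Y).prod (P.map W)
  have hd := Measure.MeasureDense.of_generateFrom_isSetAlgebra_finite (J + Q)
    (gridSets_isSetAlgebra E F) (gridSets_generate E F)
  refine le_of_forall_pos_le_add fun ε hε => ?_
  obtain ⟨T, hT, hST⟩ := hd.approx S hS (measure_ne_top _ _) (ε / 2) (by positivity)
  have hTm := hd.measurable T hT
  have h1 := tv_grid P hZ hβ k hY hW T hT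
  have bd : ∀ ρ : Measure (E × F), [IsProbabilityMeasure ρ] → ρ ≤ J + Q →
      |ρ.real S - ρ.real T| ≤ ε / 2 := by
    intro ρ _ hρ
    refine (abs_measureReal_sub_le_measureReal_symmDiff hS.nullMeasurableSet hTm.nullMeasurableSet).trans ?_
    rw [measureReal_def]
    refine ENNReal.toReal_le_of_le_ofReal (by positivity) ?_
    exact (hρ _).trans hST.le
  have h2 := bd J (Measure.le_add_right le_rfl)
  have h3 := bd Q (Measure.le_add_left le_rfl)
  rw [abs_le] at *
  constructor <;> linarith [h1.1, h1.2, h2.1, h2.2, h3.1, h3.2]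

lemma tv_fun_nonneg {E : Type*} [MeasurableSpace E] (J Q : Measure E) [IsProbabilityMeasure J]
    [IsProbabilityMeasure Q] (b : ℝ) (hb : ∀ S, MeasurableSet S → |J.real S - Q.real S| ≤ b)
    (Φ : E → ℝ) (hΦ : Measurable Φ) (M : ℝ) (h0 : ∀ x, 0 ≤ Φ x) (hM : ∀ x, Φ x ≤ M) (hM0 : 0 ≤ M) :
    |∫ x, Φ x ∂J - ∫ x, Φ x ∂Q| ≤ M * b := by
  have hInt : ∀ ρ : Measure E, [IsProbabilityMeasure ρ] → Integrable Φ ρ := fun ρ _ =>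
    Integrable.of_bound hΦ.aestronglyMeasurable M
      (Eventually.of_forall fun x => by rw [Real.norm_eq_abs, abs_of_nonneg (h0 x)]; exact hM x)
  rw [(hInt J).integral_eq_integral_Ioc_meas_le (Eventually.of_forall h0) (Eventually.of_forall hM),
    (hInt Q).integral_eq_integral_Ioc_meas_le (Eventually.of_forall h0) (Eventually.of_forall hM)]
  have hi : ∀ ρ : Measure E, [IsProbabilityMeasure ρ] →
      Integrable (fun t => ρ.real {a | t ≤ Φ a}) (volume.restrict (Ioc 0 M)) := by
    intro ρ _
    have : Antitone (fun t => ρ.real {a | t ≤ Φ a}) := fun s t hst =>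
      measureReal_mono (fun a (ha : t ≤ Φ a) => le_trans hst ha)
    exact Integrable.of_bound this.measurable.aestronglyMeasurable 1
      (Eventually.of_forall fun x => by
        rw [Real.norm_eq_abs, abs_of_nonneg measureReal_nonneg]; exact measureReal_le_one)
  rw [← integral_sub (hi J) (hi Q), ← Real.norm_eq_abs]
  refine (norm_setIntegral_le_of_norm_le_const (C := b) (by simp) ?_).trans ?_
  · intro x _
    exact hb _ (hΦ measurableSet_Ici)
  · simp [hM0, mul_comm]

lemma tv_fun {E : Type*} [MeasurableSpace E] (J Q : Measure E) [IsProbabilityMeasure J]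
    [IsProbabilityMeasure Q] (b : ℝ) (hb : ∀ S, MeasurableSet S → |J.real S - Q.real S| ≤ b)
    (Φ : E → ℝ) (hΦ : Measurable Φ) (M : ℝ) (hM : ∀ x, |Φ x| ≤ M) (hM0 : 0 ≤ M) :
    |∫ x, Φ x ∂J - ∫ x, Φ x ∂Q| ≤ 2 * M * b := by
  have h := tv_fun_nonneg J Q b hb (fun x => Φ x + M) (hΦ.add_const M) (2 * M)
    (fun x => by linarith [(abs_le.1 (hM x)).1]) (fun x => by linarith [(abs_le.1 (hM x)).2])
    (by positivity)
  have hInt : ∀ ρ : Measure E, [IsProbabilityMeasure ρ] → Integrable Φ ρ := fun ρ _ =>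
    Integrable.of_bound hΦ.aestronglyMeasurable M
      (Eventually.of_forall fun x => hM x)
  rw [integral_add (hInt J) (integrable_const _), integral_add (hInt Q) (integrable_const _)] at h
  simpa using h

/-- the path of the pair process -/
def path {Ω : Type*} (X Z : ℤ → Ω → ℝ) (ω : Ω) : ℤ → ℝ × ℝ := fun i => (X i ω, Z i ω)

lemma measurable_path {Ω : Type*} [MeasurableSpace Ω] {X Z : ℤ → Ω → ℝ}
    (hX : ∀ i, Measurable (X i)) (hZ : ∀ i, Measurable (Z i)) : Measurable (path X Z) :=
  measurable_pi_lambda _ fun i => (hX i).prodMk (hZ i)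

lemma path_stationary {Ω : Type*} [MeasurableSpace Ω] (P : Measure Ω) [IsProbabilityMeasure P]
    {X Z : ℤ → Ω → ℝ} (hX : ∀ i, Measurable (X i)) (hZ : ∀ i, Measurable (Z i))
    (hs : IsPairStationary P X Z) (c : ℤ) :
    P.map (path X Z) = P.map (path (fun i => X (i + c)) (fun i => Z (i + c))) := by
  have m1 := measurable_path hX hZ
  have m2 := measurable_path (X := fun i => X (i + c)) (Z := fun i => Z (i + c))
    (fun i => hX _) (fun i => hZ _)
  have : IsProbabilityMeasure (P.map (path X Z)) :=
    Measure.isProbabilityMeasure_map m1.aemeasurable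
  refine IsProjectiveLimit.unique (P := fun I : Finset ℤ => (P.map (path X Z)).map I.restrict)
    (fun I => rfl) ?_
  intro I
  beta_reduce
  rw [Measure.map_map (by fun_prop) m2, Measure.map_map (by fun_prop) m1]
  have e := I.equivFin
  have h := hs c I.card (fun i => ((I.equivFin.symm i : I) : ℤ))
  have hm : Measurable (fun (q : Fin I.card → ℝ × ℝ) (i : I) => q (I.equivFin i)) :=
    measurable_pi_lambda _ fun i => measurable_pi_apply _
  have h' := congrArg (Measure.map (fun (q : Fin I.card → ℝ × ℝ) (i : I) => q (I.equivFin i))) h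
  rw [Measure.map_map hm (measurable_pi_lambda _ fun i => (hX _).prodMk (hZ _)),
    Measure.map_map hm (measurable_pi_lambda _ fun i => (hX _).prodMk (hZ _))] at h'
  have e1 : (fun (q : Fin I.card → ℝ × ℝ) (i : I) => q (I.equivFin i)) ∘
      (fun ω i => (X ((I.equivFin.symm i : I) : ℤ) ω, Z ((I.equivFin.symm i : I) : ℤ) ω)) =
      I.restrict ∘ path X Z := by
    funext ω i
    simp [path]
  have e2 : (fun (q : Fin I.card → ℝ × ℝ) (i : I) => q (I.equivFin i)) ∘
      (fun ω i => (X (((I.equivFin.symm i : I) : ℤ) + c) ω,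
        Z (((I.equivFin.symm i : I) : ℤ) + c) ω)) =
      I.restrict ∘ path (fun i => X (i + c)) (fun i => Z (i + c)) := by
    funext ω i
    simp [path]
  rw [e1, e2] at h'
  exact h'.symm

/-- any functional of the path is stationary -/
lemma functional_stationary {Ω E : Type*} [MeasurableSpace Ω] [MeasurableSpace E]
    (P : Measure Ω) [IsProbabilityMeasure P]
    {X Z : ℤ → Ω → ℝ} (hX : ∀ i, Measurable (X i)) (hZ : ∀ i, Measurable (Z i))
    (hs : IsPairStationary P X Z) (c : ℤ) (Ψ : (ℤ → ℝ × ℝ) → E) (hΨ : Measurable Ψ) :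
    P.map (fun ω => Ψ (path X Z ω)) =
      P.map (fun ω => Ψ (path (fun i => X (i + c)) (fun i => Z (i + c)) ω)) := by
  have h := congrArg (Measure.map Ψ) (path_stationary P hX hZ hs c)
  rwa [Measure.map_map hΨ (measurable_path hX hZ), Measure.map_map hΨ
    (measurable_path (X := fun i => X (i + c)) (Z := fun i => Z (i + c))
    (fun i => hX _) (fun i => hZ _))] at h

/-- the finite window approximation `V_i = f(Z_{i-l}, …, Z_{i+l})` -/
def Vap {Ω : Type*} (Z : ℤ → Ω → ℝ) (l : ℕ) (f : (Fin (2 * l + 1) → ℝ) → ℝ) (i : ℤ) (ω : Ω) : ℝ :=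
  f fun a => Z (i + ((a : ℕ) : ℤ) - (l : ℤ)) ω

/-- `V_i` as a function of the path -/
def Vpath (l : ℕ) (f : (Fin (2 * l + 1) → ℝ) → ℝ) (i : ℤ) (q : ℤ → ℝ × ℝ) : ℝ :=
  f fun a => (q (i + ((a : ℕ) : ℤ) - (l : ℤ))).2

lemma measurable_Vpath (l : ℕ) (f : (Fin (2 * l + 1) → ℝ) → ℝ) (hf : Measurable f) (i : ℤ) :
    Measurable (Vpath l f i) :=
  hf.comp (measurable_pi_lambda _ fun _ => (measurable_pi_apply _).snd)

lemma Vpath_path {Ω : Type*} (X Z : ℤ → Ω → ℝ) (l : ℕ) (f : (Fin (2 * l + 1) → ℝ) → ℝ) (i : ℤ)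
    (ω : Ω) : Vpath l f i (path X Z ω) = Vap Z l f i ω := rfl

lemma Vpath_path_shift {Ω : Type*} (X Z : ℤ → Ω → ℝ) (l : ℕ) (f : (Fin (2 * l + 1) → ℝ) → ℝ)
    (i c : ℤ) (ω : Ω) :
    Vpath l f i (path (fun i => X (i + c)) (fun i => Z (i + c)) ω) = Vap Z l f (i + c) ω := by
  simp only [Vpath, path, Vap]
  congr 1
  funext a
  congr 1
  ring

lemma measurable_Vap {Ω : Type*} [MeasurableSpace Ω] {Z : ℤ → Ω → ℝ} (hZ : ∀ i, Measurable (Z i))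
    (l : ℕ) (f : (Fin (2 * l + 1) → ℝ) → ℝ) (hf : Measurable f) (i : ℤ) :
    Measurable (Vap Z l f i) :=
  hf.comp (measurable_pi_lambda _ fun _ => hZ _)

lemma Vap_past {Ω : Type*} [MeasurableSpace Ω] {Z : ℤ → Ω → ℝ}
    (l : ℕ) (f : (Fin (2 * l + 1) → ℝ) → ℝ) (hf : Measurable f) (i : ℤ) (hi : i + l ≤ 0) :
    Measurable[pastSigma Z] (Vap Z l f i) := by
  refine @Measurable.comp _ _ _ (pastSigma Z) _ _ _ _ hf ?_
  refine @measurable_pi_lambda _ _ _ (pastSigma Z) _ _ fun a => ?_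
  have ha := a.2
  have hle : MeasurableSpace.comap (Z (i + ((a : ℕ) : ℤ) - (l : ℤ))) Real.measurableSpace ≤
    pastSigma Z := le_iSup (fun i : {i : ℤ // i ≤ 0} =>
      MeasurableSpace.comap (Z i) Real.measurableSpace) ⟨i + ((a : ℕ) : ℤ) - (l : ℤ), by omega⟩
  exact (comap_measurable (Z (i + ((a : ℕ) : ℤ) - (l : ℤ)))).mono hle le_rfl

lemma Vap_future {Ω : Type*} [MeasurableSpace Ω] {Z : ℤ → Ω → ℝ}
    (l : ℕ) (f : (Fin (2 * l + 1) → ℝ) → ℝ) (hf : Measurable f) (k : ℕ) (i : ℤ)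
    (hi : (k : ℤ) ≤ i - l) :
    Measurable[futureSigma Z k] (Vap Z l f i) := by
  refine @Measurable.comp _ _ _ (futureSigma Z k) _ _ _ _ hf ?_
  refine @measurable_pi_lambda _ _ _ (futureSigma Z k) _ _ fun a => ?_
  have ha := a.2
  have hle : MeasurableSpace.comap (Z (i + ((a : ℕ) : ℤ) - (l : ℤ))) Real.measurableSpace ≤
    futureSigma Z k := le_iSup (fun i : {i : ℤ // (k : ℤ) ≤ i} =>
      MeasurableSpace.comap (Z i) Real.measurableSpace) ⟨i + ((a : ℕ) : ℤ) - (l : ℤ), by omega⟩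
  exact (comap_measurable (Z (i + ((a : ℕ) : ℤ) - (l : ℤ)))).mono hle le_rfl

lemma kernelize {Ω E F : Type*} [MeasurableSpace Ω] [MeasurableSpace E] [StandardBorelSpace E]
    [Nonempty E] [MeasurableSpace F] (P : Measure Ω) [IsProbabilityMeasure P]
    (Q : Ω → F) (R : Ω → E) (hQ : Measurable Q) (hR : Measurable R)
    (φ : F × E → ℝ≥0∞) (hφ : Measurable φ) :
    ∃ ψ : F → ℝ≥0∞, Measurable ψ ∧ (∀ q c, (∀ r, φ (q, r) ≤ c) → ψ q ≤ c) ∧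
      ∫⁻ ω, φ (Q ω, R ω) ∂P = ∫⁻ ω, ψ (Q ω) ∂P := by
  refine ⟨fun q => ∫⁻ r, φ (q, r) ∂(ProbabilityTheory.condDistrib R Q P q),
    hφ.lintegral_kernel_prod_right', ?_, ?_⟩
  · intro q c hc
    refine (lintegral_mono hc).trans ?_
    simp
  · rw [← lintegral_map (f := φ) (g := fun ω => (Q ω, R ω)) hφ (hQ.prodMk hR),
      ← ProbabilityTheory.compProd_map_condDistrib hR.aemeasurable,
      Measure.lintegral_compProd hφ,
      lintegral_map (f := fun q => ∫⁻ r, φ (q, r) ∂(ProbabilityTheory.condDistrib R Q P q))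
        hφ.lintegral_kernel_prod_right' hQ]

/-- oscillation at scale `ε` -/
def osc (H : ℝ × ℝ → ℝ) (ε : ℝ) (q : ℝ × ℝ) : ℝ := ⨆ r ∈ Metric.closedBall q ε, |H r - H q|

lemma le_osc {H : ℝ × ℝ → ℝ} {M : ℝ} (h0 : ∀ q, 0 ≤ H q) (hM : ∀ q, H q ≤ M) {ε : ℝ}
    {q r : ℝ × ℝ} (hr : r ∈ Metric.closedBall q ε) : |H r - H q| ≤ osc H ε q := by
  have hb : ∀ r, |H r - H q| ≤ M := fun r => by
    rw [abs_le]; constructor <;> linarith [h0 r, h0 q, hM r, hM q]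
  have hM0 : 0 ≤ M := (h0 q).trans (hM q)
  have := le_ciSup (f := fun r => ⨆ _ : r ∈ Metric.closedBall q ε, |H r - H q|) ?_ r
  · refine le_trans ?_ this
    simp only [hr]
    simp
  · refine ⟨M, ?_⟩
    rintro _ ⟨s, rfl⟩
    exact Real.iSup_le (fun _ => hb s) hM0

/-- Comparison with the (lower) integral of a bound, up to non-closeness. -/
lemma close_bound (κ : Measure (ℝ × ℝ)) [IsProbabilityMeasure κ] (ε δ : ℝ)
    (hδ : κ {p | ε < |p.1 - p.2|} ≤ ENNReal.ofReal δ) (hδ0 : 0 ≤ δ)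
    (φ : (ℝ × ℝ) × (ℝ × ℝ) → ℝ≥0∞) (hφ : Measurable φ) (g : ℝ × ℝ → ℝ≥0∞) (c : ℝ) (hc : 0 ≤ c)
    (hg : ∀ q r, r ∈ Metric.closedBall q ε → φ (q, r) ≤ g q)
    (hφc : ∀ p, φ p ≤ ENNReal.ofReal c) :
    ∫⁻ p, φ ((p.1.1, p.2.1), (p.1.2, p.2.2)) ∂(κ.prod κ) ≤
      ∫⁻ q, g q ∂((κ.map Prod.fst).prod (κ.map Prod.fst)) + ENNReal.ofReal (2 * c * δ) := by
  classical
  have hball : MeasurableSet {p : (ℝ × ℝ) × (ℝ × ℝ) | dist p.2 p.1 ≤ ε} :=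
    measurableSet_le (by fun_prop) (by fun_prop)
  let φ' : (ℝ × ℝ) × (ℝ × ℝ) → ℝ≥0∞ := {p | dist p.2 p.1 ≤ ε}.indicator φ
  have hφ' : Measurable φ' := hφ.indicator hball
  let Q : (ℝ × ℝ) × (ℝ × ℝ) → ℝ × ℝ := fun p => (p.1.1, p.2.1)
  let R : (ℝ × ℝ) × (ℝ × ℝ) → ℝ × ℝ := fun p => (p.1.2, p.2.2)
  have hQ : Measurable Q := by fun_prop
  have hR : Measurable R := by fun_prop
  obtain ⟨ψ, hψ, hψ1, hψ2⟩ := kernelize (κ.prod κ) Q R hQ hR φ' hφ'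
  have hψg : ∀ q, ψ q ≤ g q := by
    intro q
    refine hψ1 q (g q) fun r => ?_
    by_cases h : dist r q ≤ ε
    · simp only [φ', indicator, mem_ofPred_eq, h, if_true]
      exact hg q r h
    · simp [φ', h]
  have hQl : (κ.prod κ).map Q = (κ.map Prod.fst).prod (κ.map Prod.fst) :=
    (Measure.map_prod_map κ κ measurable_fst measurable_fst).symm
  have h1 : ∫⁻ p, φ' (Q p, R p) ∂(κ.prod κ) ≤
      ∫⁻ q, g q ∂((κ.map Prod.fst).prod (κ.map Prod.fst)) := by
    rw [hψ2, ← lintegral_map hψ hQ, hQl]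
    exact lintegral_mono hψg
  let B : Set ((ℝ × ℝ) × (ℝ × ℝ)) := {p | ε < |p.1.1 - p.1.2|} ∪ {p | ε < |p.2.1 - p.2.2|}
  have hBm : MeasurableSet B :=
    (measurableSet_lt (by fun_prop) (by fun_prop)).union
      (measurableSet_lt (by fun_prop) (by fun_prop))
  have hB : (κ.prod κ) B ≤ ENNReal.ofReal (2 * δ) := by
    refine (measure_union_le _ _).trans ?_
    have e1 : {p : (ℝ × ℝ) × (ℝ × ℝ) | ε < |p.1.1 - p.1.2|} = {p | ε < |p.1 - p.2|} ×ˢ univ := by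
      ext p; simp
    have e2 : {p : (ℝ × ℝ) × (ℝ × ℝ) | ε < |p.2.1 - p.2.2|} = univ ×ˢ {p | ε < |p.1 - p.2|} := by
      ext p; simp
    rw [e1, e2, Measure.prod_prod, Measure.prod_prod, measure_univ, one_mul, mul_one, two_mul,
      ENNReal.ofReal_add hδ0 hδ0]
    gcongr
  have h2 : ∀ p, φ (Q p, R p) ≤ φ' (Q p, R p) + B.indicator (fun _ => ENNReal.ofReal c) p := by
    intro p
    by_cases hp : dist (R p) (Q p) ≤ ε
    · have : φ' (Q p, R p) = φ (Q p, R p) := by simp [φ', hp]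
      rw [this]; exact le_self_add
    · have : p ∈ B := by
        simp only [Q, R, Prod.dist_eq, Real.dist_eq, max_le_iff, not_and_or, not_le] at hp
        rcases hp with hp | hp
        · left; rw [mem_ofPred_eq, abs_sub_comm]; exact hp
        · right; rw [mem_ofPred_eq, abs_sub_comm]; exact hp
      rw [indicator_of_mem this]
      exact (hφc _).trans le_add_self
  calc ∫⁻ p, φ (Q p, R p) ∂(κ.prod κ)
      ≤ ∫⁻ p, φ' (Q p, R p) + B.indicator (fun _ => ENNReal.ofReal c) p ∂(κ.prod κ) :=
        lintegral_mono h2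
    _ = ∫⁻ p, φ' (Q p, R p) ∂(κ.prod κ) + ENNReal.ofReal c * (κ.prod κ) B := by
        rw [lintegral_add_left (f := fun p => φ' (Q p, R p)) (hφ'.comp (hQ.prodMk hR)), lintegral_indicator hBm]
        simp
    _ ≤ _ := by
        refine add_le_add h1 ?_
        calc _ ≤ ENNReal.ofReal c * ENNReal.ofReal (2 * δ) := by gcongr
          _ = _ := by rw [← ENNReal.ofReal_mul hc]; congr 1; ring

lemma sq_sub_le {a b M : ℝ} (ha : 0 ≤ a) (hb : 0 ≤ b) (haM : a ≤ M) (hbM : b ≤ M) :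
    (a - b) ^ 2 ≤ M ^ 2 := by
  rw [sq_le_sq, abs_of_nonneg (ha.trans haM), abs_le]; constructor <;> linarith

lemma prod_approx (κ : Measure (ℝ × ℝ)) [IsProbabilityMeasure κ] (ε δ : ℝ)
    (hδ : κ {p | ε < |p.1 - p.2|} ≤ ENNReal.ofReal δ) (hδ0 : 0 ≤ δ)
    {H : ℝ × ℝ → ℝ} {M : ℝ} (hH : Measurable H) (h0 : ∀ q, 0 ≤ H q) (hM : ∀ q, H q ≤ M) (L' : ℝ)
    (hL : ∫⁻ q, ENNReal.ofReal (osc H ε q ^ 2) ∂((κ.map Prod.fst).prod (κ.map Prod.fst)) ≤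
      ENNReal.ofReal L') (hL0 : 0 ≤ L') :
    ∫⁻ p, ENNReal.ofReal ((H (p.1.1, p.2.1) - H (p.1.2, p.2.2)) ^ 2) ∂(κ.prod κ) ≤
      ENNReal.ofReal (L' + 2 * M ^ 2 * δ) := by
  have := close_bound κ ε δ hδ hδ0 (fun p => ENNReal.ofReal ((H p.1 - H p.2) ^ 2))
    (by fun_prop) (fun q => ENNReal.ofReal (osc H ε q ^ 2)) (M ^ 2) (by positivity)
    (fun q r hr => by
      apply ENNReal.ofReal_le_ofReal
      have := le_osc h0 hM hr
      rw [← sq_abs, abs_sub_comm]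
      gcongr)
    (fun p => ENNReal.ofReal_le_ofReal (sq_sub_le (h0 _) (h0 _) (hM _) (hM _)))
  refine this.trans ?_
  rw [ENNReal.ofReal_add hL0 (by positivity)]
  gcongr

lemma tv_path {Ω E F : Type*} [MeasurableSpace Ω] [MeasurableSpace E] [MeasurableSpace F]
    (P : Measure Ω) [IsProbabilityMeasure P]
    {X Z : ℤ → Ω → ℝ} (hX : ∀ i, Measurable (X i)) (hZ : ∀ i, Measurable (Z i))
    (hs : IsPairStationary P X Z) {β : ℕ → ℝ} (hβ : IsBetaBound P Z β) (k : ℕ) (c : ℤ)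
    (A : (ℤ → ℝ × ℝ) → E) (B : (ℤ → ℝ × ℝ) → F) (hA : Measurable A) (hB : Measurable B)
    (hAp : Measurable[pastSigma Z]
      fun ω => A (path (fun i => X (i + c)) (fun i => Z (i + c)) ω))
    (hBf : Measurable[futureSigma Z k]
      fun ω => B (path (fun i => X (i + c)) (fun i => Z (i + c)) ω))
    (Φ : E × F → ℝ) (hΦ : Measurable Φ) (M : ℝ) (hM : ∀ x, |Φ x| ≤ M) (hM0 : 0 ≤ M) :
    |∫ ω, Φ (A (path X Z ω), B (path X Z ω)) ∂P -
      ∫ x, Φ x ∂((P.map fun ω => A (path X Z ω)).prod (P.map fun ω => B (path X Z ω)))|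
      ≤ 4 * M * β k := by
  have mp := measurable_path hX hZ
  have mps := measurable_path (X := fun i => X (i + c)) (Z := fun i => Z (i + c))
    (fun i => hX _) (fun i => hZ _)
  have e1 : ∫ ω, Φ (A (path X Z ω), B (path X Z ω)) ∂P =
      ∫ x, Φ x ∂(P.map fun ω => (A (path X Z ω), B (path X Z ω))) := by
    rw [integral_map (φ := fun ω => (A (path X Z ω), B (path X Z ω)))
      ((hA.comp mp).prodMk (hB.comp mp)).aemeasurable hΦ.aestronglyMeasurable]
  rw [e1, functional_stationary P hX hZ hs c (fun q => (A q, B q)) (hA.prodMk hB),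
    functional_stationary P hX hZ hs c A hA, functional_stationary P hX hZ hs c B hB]
  have : IsProbabilityMeasure
      (P.map fun ω => A (path (fun i => X (i + c)) (fun i => Z (i + c)) ω)) :=
    Measure.isProbabilityMeasure_map (hA.comp mps).aemeasurable
  have : IsProbabilityMeasure
      (P.map fun ω => B (path (fun i => X (i + c)) (fun i => Z (i + c)) ω)) :=
    Measure.isProbabilityMeasure_map (hB.comp mps).aemeasurable
  have : IsProbabilityMeasure
      (P.map fun ω => (A (path (fun i => X (i + c)) (fun i => Z (i + c)) ω),
        B (path (fun i => X (i + c)) (fun i => Z (i + c)) ω))) :=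
    Measure.isProbabilityMeasure_map ((hA.comp mps).prodMk (hB.comp mps)).aemeasurable
  have := tv_fun _ _ (2 * β k) (fun S hS => tv_set P hZ hβ k hAp hBf S hS) Φ hΦ M hM hM0
  linarith

lemma law_XV {Ω : Type*} [MeasurableSpace Ω]
    (P : Measure Ω) [IsProbabilityMeasure P]
    {X Z : ℤ → Ω → ℝ} (hX : ∀ i, Measurable (X i)) (hZ : ∀ i, Measurable (Z i))
    (hs : IsPairStationary P X Z) (l : ℕ) (f : (Fin (2 * l + 1) → ℝ) → ℝ) (hf : Measurable f)
    (i : ℤ) :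
    P.map (fun ω => (X i ω, Vap Z l f i ω)) = P.map (fun ω => (X 0 ω, Vap Z l f 0 ω)) := by
  have := functional_stationary P hX hZ hs i (fun q => ((q 0).1, Vpath l f 0 q))
    ((measurable_pi_apply _).fst.prodMk (measurable_Vpath l f hf 0))
  have e : ∀ ω, Vpath l f 0 (path (fun i' => X (i' + i)) (fun i' => Z (i' + i)) ω) =
      Vap Z l f i ω := fun ω => by rw [Vpath_path_shift, zero_add]
  simp only [e] at this
  simp only [Vpath_path, path, zero_add] at this
  exact this.symm

lemma law_V {Ω : Type*} [MeasurableSpace Ω]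
    (P : Measure Ω) [IsProbabilityMeasure P]
    {X Z : ℤ → Ω → ℝ} (hX : ∀ i, Measurable (X i)) (hZ : ∀ i, Measurable (Z i))
    (hs : IsPairStationary P X Z) (l : ℕ) (f : (Fin (2 * l + 1) → ℝ) → ℝ) (hf : Measurable f)
    (i : ℤ) :
    P.map (Vap Z l f i) = P.map (Vap Z l f 0) := by
  have := congrArg (Measure.map Prod.snd) (law_XV P hX hZ hs l f hf i)
  rwa [Measure.map_map measurable_snd ((hX _).prodMk (measurable_Vap hZ l f hf _)),
    Measure.map_map measurable_snd ((hX _).prodMk (measurable_Vap hZ l f hf _))] at this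

lemma pair_approx {Ω : Type*} [MeasurableSpace Ω]
    (P : Measure Ω) [IsProbabilityMeasure P]
    {X Z : ℤ → Ω → ℝ} (hX : ∀ i, Measurable (X i)) (hZ : ∀ i, Measurable (Z i))
    (hs : IsPairStationary P X Z) {β : ℕ → ℝ} (hβ : IsBetaBound P Z β) (hβ0 : ∀ k, 0 ≤ β k)
    (l : ℕ) (f : (Fin (2 * l + 1) → ℝ) → ℝ) (hf : Measurable f)
    (k : ℕ) (i j : ℤ) (hij : i + 2 * l + k ≤ j) (ε δ : ℝ)
    (hδ : P {ω | ε < |X 0 ω - Vap Z l f 0 ω|} ≤ ENNReal.ofReal δ) (hδ0 : 0 ≤ δ)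
    {H : ℝ × ℝ → ℝ} {M : ℝ} (hH : Measurable H) (h0 : ∀ q, 0 ≤ H q) (hM : ∀ q, H q ≤ M) (L' : ℝ)
    (hL : ∫⁻ q, ENNReal.ofReal (osc H (2 * ε) q ^ 2) ∂((P.map (X 0)).prod (P.map (X 0))) ≤
      ENNReal.ofReal L') (hL0 : 0 ≤ L') :
    ∫⁻ ω, ENNReal.ofReal ((H (X i ω, X j ω) - H (Vap Z l f i ω, Vap Z l f j ω)) ^ 2) ∂P ≤
      ENNReal.ofReal (4 * L' + 4 * M ^ 2 * δ + 4 * M ^ 2 * β k) := by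
  classical
  have mV := measurable_Vap hZ l f hf
  set V := Vap Z l f with hVdef
  set κ := P.map (fun ω => (X 0 ω, V 0 ω)) with hκ
  have mXV : ∀ i, Measurable (fun ω => (X i ω, V i ω)) := fun i => (hX i).prodMk (mV i)
  have : IsProbabilityMeasure κ := Measure.isProbabilityMeasure_map (mXV 0).aemeasurable
  have : IsProbabilityMeasure (P.map (V 0)) := Measure.isProbabilityMeasure_map (mV 0).aemeasurable
  have mbad : MeasurableSet {p : ℝ × ℝ | ε < |p.1 - p.2|} :=
    measurableSet_lt (by fun_prop) (by fun_prop)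
  have hκδ : κ {p | ε < |p.1 - p.2|} ≤ ENNReal.ofReal δ := by
    rw [hκ, Measure.map_apply (mXV 0) mbad]; exact hδ
  have hPδ : ∀ i, P {ω | ε < |X i ω - V i ω|} ≤ ENNReal.ofReal δ := by
    intro i
    rw [hκ, ← law_XV P hX hZ hs l f hf i, Measure.map_apply (mXV i) mbad] at hκδ
    exact hκδ
  -- step 1
  have hball : MeasurableSet {p : (ℝ × ℝ) × (ℝ × ℝ) | dist p.2 p.1 ≤ ε} :=
    measurableSet_le (by fun_prop) (by fun_prop)
  let φ : (ℝ × ℝ) × (ℝ × ℝ) → ℝ≥0∞ :=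
    {p | dist p.2 p.1 ≤ ε}.indicator fun p => ENNReal.ofReal ((H p.2 - H p.1) ^ 2)
  have hφ : Measurable φ := Measurable.indicator (by fun_prop) hball
  have hφc : ∀ p, φ p ≤ ENNReal.ofReal (M ^ 2) := by
    intro p
    by_cases hp : dist p.2 p.1 ≤ ε
    · simp only [φ, indicator, mem_ofPred_eq, hp, if_true]
      exact ENNReal.ofReal_le_ofReal (sq_sub_le (h0 _) (h0 _) (hM _) (hM _))
    · simp [φ, hp]
  obtain ⟨ψ, hψ, hψ1, hψ2⟩ := kernelize P (fun ω => (V i ω, V j ω)) (fun ω => (X i ω, X j ω))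
    ((mV i).prodMk (mV j)) ((hX i).prodMk (hX j)) φ hφ
  have hψc : ∀ q, ψ q ≤ ENNReal.ofReal (M ^ 2) := fun q => hψ1 q _ fun r => hφc _
  let B : Set Ω := {ω | ε < |X i ω - V i ω|} ∪ {ω | ε < |X j ω - V j ω|}
  have hBm : MeasurableSet B := ((mXV i) mbad).union ((mXV j) mbad)
  have hB : P B ≤ ENNReal.ofReal (2 * δ) := by
    refine (measure_union_le _ _).trans ?_
    rw [two_mul, ENNReal.ofReal_add hδ0 hδ0]
    exact add_le_add (hPδ i) (hPδ j)
  have h2 : ∀ ω, ENNReal.ofReal ((H (X i ω, X j ω) - H (V i ω, V j ω)) ^ 2) ≤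
      φ ((V i ω, V j ω), (X i ω, X j ω)) + B.indicator (fun _ => ENNReal.ofReal (M ^ 2)) ω := by
    intro ω
    by_cases hp : dist (X i ω, X j ω) (V i ω, V j ω) ≤ ε
    · have : φ ((V i ω, V j ω), (X i ω, X j ω)) =
        ENNReal.ofReal ((H (X i ω, X j ω) - H (V i ω, V j ω)) ^ 2) := by simp [φ, hp]
      rw [this]; exact le_self_add
    · have : ω ∈ B := by
        simp only [Prod.dist_eq, Real.dist_eq, max_le_iff, not_and_or, not_le] at hp
        rcases hp with hp | hp
        · left; exact hp
        · right; exact hp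
      rw [indicator_of_mem this]
      exact (ENNReal.ofReal_le_ofReal (sq_sub_le (h0 _) (h0 _) (hM _) (hM _))).trans le_add_self
  have s1 : ∫⁻ ω, ENNReal.ofReal ((H (X i ω, X j ω) - H (V i ω, V j ω)) ^ 2) ∂P ≤
      ∫⁻ ω, ψ (V i ω, V j ω) ∂P + ENNReal.ofReal (2 * M ^ 2 * δ) := by
    calc _ ≤ ∫⁻ ω, φ ((V i ω, V j ω), (X i ω, X j ω)) +
          B.indicator (fun _ => ENNReal.ofReal (M ^ 2)) ω ∂P := lintegral_mono h2
      _ = ∫⁻ ω, φ ((V i ω, V j ω), (X i ω, X j ω)) ∂P + ENNReal.ofReal (M ^ 2) * P B := by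
        rw [lintegral_add_left (f := fun ω => φ ((V i ω, V j ω), (X i ω, X j ω)))
          (hφ.comp (((mV i).prodMk (mV j)).prodMk ((hX i).prodMk (hX j)))),
          lintegral_indicator hBm]
        simp
      _ ≤ _ := by
        rw [hψ2]
        gcongr
        calc _ ≤ ENNReal.ofReal (M ^ 2) * ENNReal.ofReal (2 * δ) := by gcongr
          _ = _ := by rw [← ENNReal.ofReal_mul (by positivity)]; congr 1; ring
  -- step 2
  have hψtop : ∀ q, ψ q ≠ ∞ := fun q => ne_top_of_le_ne_top ENNReal.ofReal_ne_top (hψc q)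
  have hψr : ∀ q, |(ψ q).toReal| ≤ M ^ 2 := fun q => by
    rw [abs_of_nonneg ENNReal.toReal_nonneg]
    exact ENNReal.toReal_le_of_le_ofReal (by positivity) (hψc q)
  have tv := tv_path P hX hZ hs hβ k (-i - l) (Vpath l f i) (Vpath l f j)
    (measurable_Vpath l f hf i) (measurable_Vpath l f hf j)
    (by simp only [Vpath_path_shift]; exact Vap_past l f hf _ (by omega))
    (by simp only [Vpath_path_shift]; exact Vap_future l f hf _ _ (by omega))
    (fun q => (ψ q).toReal) hψ.ennreal_toReal (M ^ 2) hψr (by positivity)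
  simp only [Vpath_path] at tv
  rw [law_V P hX hZ hs l f hf i, law_V P hX hZ hs l f hf j] at tv
  have hInt : ∀ ρ : Measure (ℝ × ℝ), [IsProbabilityMeasure ρ] →
      ENNReal.ofReal (∫ q, (ψ q).toReal ∂ρ) = ∫⁻ q, ψ q ∂ρ := by
    intro ρ _
    rw [ofReal_integral_eq_lintegral_ofReal]
    · simp only [ENNReal.ofReal_toReal (hψtop _)]
    · exact Integrable.of_bound hψ.ennreal_toReal.aestronglyMeasurable (M ^ 2)
        (Eventually.of_forall hψr)
    · exact Eventually.of_forall fun q => ENNReal.toReal_nonneg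
  have hVV : IsProbabilityMeasure (P.map fun ω => (V i ω, V j ω)) :=
    Measure.isProbabilityMeasure_map ((mV i).prodMk (mV j)).aemeasurable
  have s2 : ∫⁻ ω, ψ (V i ω, V j ω) ∂P ≤
      ∫⁻ q, ψ q ∂((P.map (V 0)).prod (P.map (V 0))) + ENNReal.ofReal (4 * M ^ 2 * β k) := by
    rw [← lintegral_map (f := ψ) hψ ((mV i).prodMk (mV j)), ← hInt, ← hInt,
      ← ENNReal.ofReal_add (integral_nonneg fun q => ENNReal.toReal_nonneg)
        (mul_nonneg (by positivity) (hβ0 k)),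
      integral_map ((mV i).prodMk (mV j)).aemeasurable hψ.ennreal_toReal.aestronglyMeasurable]
    apply ENNReal.ofReal_le_ofReal
    linarith [(abs_le.1 tv).2]
  -- step 3
  have hmap : (κ.prod κ).map (fun p => (p.1.2, p.2.2)) = (P.map (V 0)).prod (P.map (V 0)) := by
    have e : P.map (V 0) = κ.map Prod.snd := by
      rw [hκ, Measure.map_map measurable_snd (mXV 0)]; rfl
    rw [e]
    exact (Measure.map_prod_map κ κ measurable_snd measurable_snd).symm
  have hfst : κ.map Prod.fst = P.map (X 0) := by
    rw [hκ, Measure.map_map measurable_fst (mXV 0)]; rfl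
  have s3 : ∫⁻ q, ψ q ∂((P.map (V 0)).prod (P.map (V 0))) ≤
      ENNReal.ofReal (4 * L' + 2 * M ^ 2 * δ) := by
    rw [← hmap, lintegral_map hψ (by fun_prop)]
    have cb := close_bound κ ε δ hκδ hδ0 (fun p => ψ p.2) (hψ.comp measurable_snd)
      (fun q => ENNReal.ofReal 4 * ENNReal.ofReal (osc H (2 * ε) q ^ 2)) (M ^ 2) (by positivity)
      (by
        intro q r hr
        apply hψ1
        intro s
        by_cases hp : dist s r ≤ ε
        · simp only [φ, indicator, mem_ofPred_eq, hp, if_true]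
          rw [← ENNReal.ofReal_mul (by norm_num)]
          apply ENNReal.ofReal_le_ofReal
          have hr' : dist r q ≤ ε := hr
          have hε : 0 ≤ ε := dist_nonneg.trans hp
          have a1 := le_osc h0 hM (q := q) (r := r) (ε := 2 * ε)
            (by rw [Metric.mem_closedBall]; linarith)
          have a2 := le_osc h0 hM (q := q) (r := s) (ε := 2 * ε)
            (by rw [Metric.mem_closedBall]; linarith [dist_triangle s r q])
          have a3 : |H s - H r| ≤ 2 * osc H (2 * ε) q := by
            rw [abs_le] at *
            constructor <;> linarith [a1.1, a1.2, a2.1, a2.2]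
          calc (H s - H r) ^ 2 = |H s - H r| ^ 2 := (sq_abs _).symm
            _ ≤ (2 * osc H (2 * ε) q) ^ 2 := by gcongr
            _ = _ := by ring
        · simp [φ, hp])
      (fun p => hψc _)
    refine cb.trans ?_
    rw [lintegral_const_mul' _ _ ENNReal.ofReal_ne_top, hfst,
      ENNReal.ofReal_add (by positivity) (by positivity),
      ENNReal.ofReal_mul (p := 4) (q := L') (by norm_num)]
    gcongr
  calc _ ≤ _ := s1
    _ ≤ (ENNReal.ofReal (4 * L' + 2 * M ^ 2 * δ) + ENNReal.ofReal (4 * M ^ 2 * β k)) +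
        ENNReal.ofReal (2 * M ^ 2 * δ) := by
        gcongr
        exact s2.trans (by gcongr)
    _ = _ := by
        have := hβ0 k
        rw [← ENNReal.ofReal_add (by positivity) (by positivity),
          ← ENNReal.ofReal_add (by positivity) (by positivity)]
        congr 1; ring

lemma eL2_le {Ω : Type*} [MeasurableSpace Ω] (P : Measure Ω) (g : Ω → ℝ) (c : ℝ) (hc : 0 ≤ c)
    (h : ∫⁻ ω, ENNReal.ofReal (g ω ^ 2) ∂P ≤ ENNReal.ofReal (c ^ 2)) :
    eLpNorm g 2 P ≤ ENNReal.ofReal c := by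
  rw [eLpNorm_eq_lintegral_rpow_enorm_toReal (by norm_num) (by norm_num)]
  have e : ∀ ω, ‖g ω‖ₑ ^ (2 : ℝ≥0∞).toReal = ENNReal.ofReal (g ω ^ 2) := by
    intro ω
    rw [Real.enorm_eq_ofReal_abs, ENNReal.ofReal_rpow_of_nonneg (abs_nonneg _) (by norm_num)]
    simp
  simp only [e]
  calc _ ≤ ENNReal.ofReal (c ^ 2) ^ (1 / (2 : ℝ≥0∞).toReal) := by gcongr
    _ = ENNReal.ofReal c := by
      rw [ENNReal.ofReal_rpow_of_nonneg (by positivity) (by norm_num)]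
      congr 1
      rw [← Real.rpow_natCast, ← Real.rpow_mul hc]
      simp

lemma jensen_sq {E : Type*} [MeasurableSpace E] (κ : Measure E) [IsProbabilityMeasure κ]
    (f : E → ℝ) (hf : Measurable f) (M : ℝ) (hM : ∀ x, |f x| ≤ M) :
    ENNReal.ofReal ((∫ x, f x ∂κ) ^ 2) ≤ ∫⁻ x, ENNReal.ofReal (f x ^ 2) ∂κ := by
  have i1 : Integrable f κ := Integrable.of_bound hf.aestronglyMeasurable M
    (Eventually.of_forall hM)
  have i2 : Integrable (fun x => f x ^ 2) κ :=
    Integrable.of_bound (hf.pow_const 2).aestronglyMeasurable (M ^ 2)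
    (Eventually.of_forall fun x => by
      rw [Real.norm_eq_abs, abs_pow]
      exact pow_le_pow_left₀ (abs_nonneg _) (hM x) 2)
  rw [← ofReal_integral_eq_lintegral_ofReal i2 (Eventually.of_forall fun x => by positivity)]
  apply ENNReal.ofReal_le_ofReal
  set m := ∫ x, f x ∂κ
  have : 0 ≤ ∫ x, (f x ^ 2 - 2 * m * f x + m ^ 2) ∂κ :=
    integral_nonneg fun x => by
      show 0 ≤ f x ^ 2 - 2 * m * f x + m ^ 2
      nlinarith [sq_nonneg (f x - m)]
  rw [integral_add (f := fun x => f x ^ 2 - 2 * m * f x) (i2.sub (i1.const_mul _))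
    (integrable_const _),
    integral_sub i2 (i1.const_mul _), integral_const_mul] at this
  simp at this
  nlinarith

lemma bdd_diff {a b M : ℝ} (ha : 0 ≤ a) (hb : 0 ≤ b) (haM : a ≤ M) (hbM : b ≤ M) :
    |a - b| ≤ M := by
  rw [abs_le]; constructor <;> linarith

lemma proj_approx (κ : Measure (ℝ × ℝ)) [IsProbabilityMeasure κ]
    {H : ℝ × ℝ → ℝ} {M : ℝ} (hH : Measurable H) (h0 : ∀ q, 0 ≤ H q) (hM : ∀ q, H q ≤ M) :
    ∫⁻ p, ENNReal.ofReal (((∫ y, H (p.1, y) ∂(κ.map Prod.fst)) -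
      ∫ y, H (p.2, y) ∂(κ.map Prod.snd)) ^ 2) ∂κ ≤
    ∫⁻ p, ENNReal.ofReal ((H (p.1.1, p.2.1) - H (p.1.2, p.2.2)) ^ 2) ∂(κ.prod κ) := by
  rw [lintegral_prod _ (by fun_prop)]
  refine lintegral_mono fun p => ?_
  have ms : ∀ x, Measurable (fun y => H (x, y)) := fun x => by fun_prop
  rw [integral_map (by fun_prop) (ms _).aestronglyMeasurable,
    integral_map (by fun_prop) (ms _).aestronglyMeasurable]
  have hb : ∀ q, ‖H q‖ ≤ M := fun q => by rw [Real.norm_eq_abs, abs_of_nonneg (h0 q)]; exact hM q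
  have i : ∀ g : ℝ × ℝ → ℝ × ℝ, Measurable g → Integrable (fun q => H (g q)) κ := fun g hg =>
    Integrable.of_bound (hH.comp hg).aestronglyMeasurable M (Eventually.of_forall fun q => hb _)
  rw [← integral_sub (i (fun q => (p.1, q.1)) (by fun_prop)) (i (fun q => (p.2, q.2)) (by fun_prop))]
  exact jensen_sq κ (fun q => H (p.1, q.1) - H (p.2, q.2)) (by fun_prop) M
    fun q => bdd_diff (h0 _) (h0 _) (hM _) (hM _)

lemma projU_approx (κ : Measure (ℝ × ℝ)) [IsProbabilityMeasure κ]
    {H : ℝ × ℝ → ℝ} {M : ℝ} (hH : Measurable H) (h0 : ∀ q, 0 ≤ H q) (hM : ∀ q, H q ≤ M) :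
    ENNReal.ofReal (((∫ x, ∫ y, H (x, y) ∂(κ.map Prod.fst) ∂(κ.map Prod.fst)) -
      ∫ x, ∫ y, H (x, y) ∂(κ.map Prod.snd) ∂(κ.map Prod.snd)) ^ 2) ≤
    ∫⁻ p, ENNReal.ofReal ((H (p.1.1, p.2.1) - H (p.1.2, p.2.2)) ^ 2) ∂(κ.prod κ) := by
  have : IsProbabilityMeasure (κ.map Prod.fst) :=
    Measure.isProbabilityMeasure_map measurable_fst.aemeasurable
  have : IsProbabilityMeasure (κ.map Prod.snd) :=
    Measure.isProbabilityMeasure_map measurable_snd.aemeasurable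
  refine le_trans ?_ (proj_approx κ hH h0 hM)
  have m : ∀ ρ : Measure ℝ, [IsProbabilityMeasure ρ] → Measurable (fun x => ∫ y, H (x, y) ∂ρ) :=
    fun ρ _ => (hH.stronglyMeasurable.integral_prod_right').measurable
  have m1 := m (κ.map Prod.fst)
  have m2 := m (κ.map Prod.snd)
  have b0 : ∀ ρ : Measure ℝ, [IsProbabilityMeasure ρ] → ∀ x, 0 ≤ ∫ y, H (x, y) ∂ρ :=
    fun ρ _ x => integral_nonneg fun y => h0 _
  have bM : ∀ ρ : Measure ℝ, [IsProbabilityMeasure ρ] → ∀ x, ∫ y, H (x, y) ∂ρ ≤ M := by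
    intro ρ _ x
    have : ∫ y, H (x, y) ∂ρ ≤ ∫ y, M ∂ρ := by
      refine integral_mono_of_nonneg (Eventually.of_forall fun y => h0 _) (integrable_const _)
        (Eventually.of_forall fun y => hM _)
    simpa using this
  rw [integral_map (by fun_prop) m1.aestronglyMeasurable,
    integral_map (by fun_prop) m2.aestronglyMeasurable]
  have i : ∀ (ρ : Measure ℝ) [IsProbabilityMeasure ρ] (g : ℝ × ℝ → ℝ), Measurable g →
      Integrable (fun q => ∫ y, H (g q, y) ∂ρ) κ := fun ρ _ g hg =>
    Integrable.of_bound ((m ρ).comp hg).aestronglyMeasurable M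
      (Eventually.of_forall fun q => by
        rw [Real.norm_eq_abs, abs_of_nonneg (b0 ρ _)]; exact bM ρ _)
  rw [← integral_sub (i _ _ measurable_fst) (i _ _ measurable_snd)]
  exact jensen_sq κ _ ((m1.comp measurable_fst).sub (m2.comp measurable_snd)) M
    fun q => bdd_diff (b0 _ _) (b0 _ _) (bM _ _) (bM _ _)

lemma D_bound {Ω : Type*} [MeasurableSpace Ω]
    (P : Measure Ω) [IsProbabilityMeasure P]
    {X Z : ℤ → Ω → ℝ} (hX : ∀ i, Measurable (X i)) (hZ : ∀ i, Measurable (Z i))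
    (hs : IsPairStationary P X Z) {β : ℕ → ℝ} (hβ : IsBetaBound P Z β) (hβ0 : ∀ k, 0 ≤ β k)
    (l : ℕ) (f : (Fin (2 * l + 1) → ℝ) → ℝ) (hf : Measurable f)
    (k : ℕ) (i j : ℤ) (hij : i + 2 * l + k ≤ j) (ε Cδ : ℝ) (hε : 0 < ε) (hCδ : 0 ≤ Cδ)
    (hδ : P {ω | ε < |X 0 ω - Vap Z l f 0 ω|} ≤ ENNReal.ofReal (Cδ * ε))
    (h : ℝ → ℝ → ℝ → ℝ) (t : ℝ) {M : ℝ} (hH : Measurable (fun q : ℝ × ℝ => h q.1 q.2 t))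
    (h0 : ∀ x y, 0 ≤ h x y t) (hM : ∀ x y, h x y t ≤ M) (L : ℝ) (hL0 : 0 ≤ L)
    (hL : VariationAt (P.map (X 0)) h L t) :
    eLpNorm (fun ω => h2 (P.map (X 0)) h (X i ω) (X j ω) t -
      h2 (P.map (Vap Z l f 0)) h (Vap Z l f i ω) (Vap Z l f j ω) t) 2 P ≤
      ENNReal.ofReal (4 * √((8 * L + 4 * M ^ 2 * Cδ) * ε) + 2 * M * √(β k)) := by
  have mV := measurable_Vap hZ l f hf
  have hM0 : 0 ≤ M := (h0 0 0).trans (hM 0 0)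
  set V := Vap Z l f with hVdef
  set κ := P.map (fun ω => (X 0 ω, V 0 ω)) with hκ
  have mXV : ∀ i, Measurable (fun ω => (X i ω, V i ω)) := fun i => (hX i).prodMk (mV i)
  have : IsProbabilityMeasure κ := Measure.isProbabilityMeasure_map (mXV 0).aemeasurable
  have hfst : κ.map Prod.fst = P.map (X 0) := by
    rw [hκ, Measure.map_map measurable_fst (mXV 0)]; rfl
  have hsnd : κ.map Prod.snd = P.map (V 0) := by
    rw [hκ, Measure.map_map measurable_snd (mXV 0)]; rfl
  have mbad : MeasurableSet {p : ℝ × ℝ | ε < |p.1 - p.2|} :=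
    measurableSet_lt (by fun_prop) (by fun_prop)
  have hκδ : κ {p | ε < |p.1 - p.2|} ≤ ENNReal.ofReal (Cδ * ε) := by
    rw [hκ, Measure.map_apply (mXV 0) mbad]; exact hδ
  set μ := P.map (X 0) with hμ
  set ν := P.map (V 0) with hν
  have : IsProbabilityMeasure μ := Measure.isProbabilityMeasure_map (hX 0).aemeasurable
  have : IsProbabilityMeasure ν := Measure.isProbabilityMeasure_map (mV 0).aemeasurable
  let H : ℝ × ℝ → ℝ := fun q => h q.1 q.2 t
  have h0' : ∀ q, 0 ≤ H q := fun q => h0 _ _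
  have hM' : ∀ q, H q ≤ M := fun q => hM _ _
  set R := (8 * L + 4 * M ^ 2 * Cδ) * ε with hR
  have hR0 : 0 ≤ R := by positivity
  have e2 := prod_approx κ ε (Cδ * ε) hκδ (by positivity) (H := H) hH h0' hM' (L * ε)
    (by rw [hfst]; exact hL ε hε) (by positivity)
  have e2' : ∫⁻ p, ENNReal.ofReal ((H (p.1.1, p.2.1) - H (p.1.2, p.2.2)) ^ 2) ∂(κ.prod κ) ≤
      ENNReal.ofReal (√R ^ 2) := by
    refine e2.trans (ENNReal.ofReal_le_ofReal ?_)
    rw [Real.sq_sqrt hR0, hR]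
    have : 0 ≤ L * ε := by positivity
    have : 0 ≤ M ^ 2 * Cδ * ε := by positivity
    nlinarith
  have p2 := pair_approx P hX hZ hs hβ hβ0 l f hf k i j hij ε (Cδ * ε) hδ (by positivity)
    (H := H) hH h0' hM' (L * (2 * ε)) (hL (2 * ε) (by positivity)) (by positivity)
  have a1 : eLpNorm (fun ω => H (X i ω, X j ω) - H (V i ω, V j ω)) 2 P ≤
      ENNReal.ofReal (√R + 2 * M * √(β k)) := by
    refine eL2_le P _ _ (by positivity) (p2.trans (ENNReal.ofReal_le_ofReal ?_))
    have q1 := Real.sq_sqrt hR0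
    have q2 := Real.sq_sqrt (hβ0 k)
    have : 0 ≤ √R * (M * √(β k)) := by positivity
    calc _ = R + 4 * M ^ 2 * β k := by rw [hR]; ring
      _ = √R ^ 2 + 4 * M ^ 2 * √(β k) ^ 2 := by rw [q1, q2]
      _ ≤ _ := by nlinarith
  let b : ℝ × ℝ → ℝ := fun p => (∫ y, H (p.1, y) ∂μ) - ∫ y, H (p.2, y) ∂ν
  have m : ∀ ρ : Measure ℝ, [IsProbabilityMeasure ρ] → Measurable (fun x => ∫ y, H (x, y) ∂ρ) :=
    fun ρ _ => (hH.stronglyMeasurable.integral_prod_right').measurable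
  have mb : Measurable b := ((m μ).comp measurable_fst).sub ((m ν).comp measurable_snd)
  have a2 : ∀ i, eLpNorm (fun ω => b (X i ω, V i ω)) 2 P ≤ ENNReal.ofReal √R := by
    intro i
    refine eL2_le P _ _ (by positivity) (le_trans ?_ e2')
    have := proj_approx κ (H := H) hH h0' hM'
    rw [hfst, hsnd] at this
    refine le_trans (le_of_eq ?_) this
    rw [hκ, ← law_XV P hX hZ hs l f hf i, lintegral_map _ (mXV i)]
    exact (mb.pow_const 2).ennreal_ofReal
  let u : ℝ := Udist μ h t - Udist ν h t
  have a3 : eLpNorm (fun _ : Ω => u) 2 P ≤ ENNReal.ofReal √R := by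
    refine eL2_le P _ _ (by positivity) (le_trans ?_ e2')
    have := projU_approx κ (H := H) hH h0' hM'
    rw [hfst, hsnd] at this
    rw [lintegral_const, measure_univ, mul_one]
    exact this
  have dec : (fun ω => h2 μ h (X i ω) (X j ω) t - h2 ν h (V i ω) (V j ω) t) =
      (((fun ω => H (X i ω, X j ω) - H (V i ω, V j ω)) - fun ω => b (X i ω, V i ω)) -
        fun ω => b (X j ω, V j ω)) + fun _ => u := by
    funext ω
    simp only [Pi.add_apply, Pi.sub_apply, h2, h1, b, H, u]
    ring
  have n1 : AEStronglyMeasurable (fun ω => H (X i ω, X j ω) - H (V i ω, V j ω)) P :=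
    ((hH.comp ((hX i).prodMk (hX j))).sub (hH.comp ((mV i).prodMk (mV j)))).aestronglyMeasurable
  have n2 : ∀ i, AEStronglyMeasurable (fun ω => b (X i ω, V i ω)) P := fun i =>
    (mb.comp (mXV i)).aestronglyMeasurable
  rw [dec]
  refine (eLpNorm_add_le ((n1.sub (n2 i)).sub (n2 j)) aestronglyMeasurable_const (by norm_num)).trans ?_
  have s1 := eLpNorm_sub_le (n1.sub (n2 i)) (n2 j) (p := 2) (by norm_num)
  have s2 := eLpNorm_sub_le n1 (n2 i) (p := 2) (by norm_num)
  calc _ ≤ ENNReal.ofReal (√R + 2 * M * √(β k)) + ENNReal.ofReal √R + ENNReal.ofReal √R +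
        ENNReal.ofReal √R :=
        add_le_add (s1.trans (add_le_add (s2.trans (add_le_add a1 (a2 i))) (a2 j))) a3
    _ = _ := by
      rw [← ENNReal.ofReal_add (by positivity) (by positivity),
        ← ENNReal.ofReal_add (by positivity) (by positivity),
        ← ENNReal.ofReal_add (by positivity) (by positivity)]
      congr 1; ring

lemma measurable_triple {Ω : Type*} (m : MeasurableSpace Ω) {a b c : Ω → ℝ} (ha : Measurable[m] a)
    (hb : Measurable[m] b) (hc : Measurable[m] c) : Measurable[m] fun ω => (a ω, b ω, c ω) :=
  ha.prodMk (hb.prodMk hc)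

lemma h2_props (ν : Measure ℝ) [IsProbabilityMeasure ν] (h : ℝ → ℝ → ℝ → ℝ) (t : ℝ) {M : ℝ}
    (hH : Measurable (fun q : ℝ × ℝ => h q.1 q.2 t))
    (h0 : ∀ x y, 0 ≤ h x y t) (hM : ∀ x y, h x y t ≤ M) (hsym : ∀ x y, h x y t = h y x t) :
    Measurable (fun q : ℝ × ℝ => h2 ν h q.1 q.2 t) ∧ (∀ x y, |h2 ν h x y t| ≤ 2 * M) ∧
      (∀ x y, h2 ν h x y t = h2 ν h y x t) ∧ ∀ y, ∫ x, h2 ν h x y t ∂ν = 0 := by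
  have m : Measurable (fun x => ∫ y, h x y t ∂ν) :=
    (hH.stronglyMeasurable.integral_prod_right').measurable
  have b0 : ∀ x, 0 ≤ ∫ y, h x y t ∂ν := fun x => integral_nonneg fun y => h0 _ _
  have bM : ∀ x, ∫ y, h x y t ∂ν ≤ M := by
    intro x
    have : ∫ y, h x y t ∂ν ≤ ∫ y, M ∂ν :=
      integral_mono_of_nonneg (Eventually.of_forall fun y => h0 _ _) (integrable_const _)
        (Eventually.of_forall fun y => hM _ _)
    simpa using this
  have ia : Integrable (fun x => ∫ y, h x y t ∂ν) ν :=
    Integrable.of_bound m.aestronglyMeasurable M (Eventually.of_forall fun x => by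
      rw [Real.norm_eq_abs, abs_of_nonneg (b0 x)]; exact bM x)
  have u0 : 0 ≤ Udist ν h t := integral_nonneg b0
  have uM : Udist ν h t ≤ M := by
    have : Udist ν h t ≤ ∫ y, M ∂ν :=
      integral_mono_of_nonneg (Eventually.of_forall b0) (integrable_const _)
        (Eventually.of_forall bM)
    simpa using this
  refine ⟨?_, ?_, ?_, ?_⟩
  · simp only [h2, h1]
    exact ((hH.sub ((m.comp measurable_fst).sub_const _)).sub
      ((m.comp measurable_snd).sub_const _)).sub_const _
  · intro x y
    simp only [h2, h1]
    rw [abs_le]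
    constructor <;> linarith [h0 x y, hM x y, b0 x, b0 y, bM x, bM y]
  · intro x y
    simp only [h2, h1]
    rw [hsym x y]; ring
  · intro y
    have mh : Measurable (fun x => h x y t) := hH.comp (measurable_id.prodMk measurable_const)
    have ih : Integrable (fun x => h x y t) ν :=
      Integrable.of_bound mh.aestronglyMeasurable M (Eventually.of_forall fun x => by
        rw [Real.norm_eq_abs, abs_of_nonneg (h0 x y)]; exact hM x y)
    have e : (fun x => h2 ν h x y t) = fun x => h x y t - (∫ y, h x y t ∂ν) -
        ((∫ y', h y y' t ∂ν) - Udist ν h t) := by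
      funext x; simp only [h2, h1]; ring
    rw [e, integral_sub (f := fun x => h x y t - ∫ y, h x y t ∂ν) (ih.sub ia) (integrable_const _),
      integral_sub ih ia, integral_const, probReal_univ, one_smul]
    have : ∫ x, h x y t ∂ν = ∫ x, h y x t ∂ν := by simp only [hsym _ y]
    rw [this]
    simp only [Udist]
    ring

lemma cov_last {Ω : Type*} [MeasurableSpace Ω]
    (P : Measure Ω) [IsProbabilityMeasure P]
    {X Z : ℤ → Ω → ℝ} (hX : ∀ i, Measurable (X i)) (hZ : ∀ i, Measurable (Z i))
    (hs : IsPairStationary P X Z) {β : ℕ → ℝ} (hβ : IsBetaBound P Z β)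
    (l : ℕ) (f : (Fin (2 * l + 1) → ℝ) → ℝ) (hf : Measurable f)
    (g : ℝ → ℝ → ℝ) (hg : Measurable (fun q : ℝ × ℝ => g q.1 q.2)) (B : ℝ)
    (hB : ∀ x y, |g x y| ≤ B) (hdeg : ∀ y, ∫ x, g x y ∂(P.map (Vap Z l f 0)) = 0)
    (s : ℕ) (a b c d : ℤ) (hb : b + 2 * l + s ≤ a) (hc : c + 2 * l + s ≤ a)
    (hd : d + 2 * l + s ≤ a) :
    |∫ ω, g (Vap Z l f a ω) (Vap Z l f b ω) * g (Vap Z l f c ω) (Vap Z l f d ω) ∂P| ≤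
      4 * B ^ 2 * β s := by
  have hB0 : 0 ≤ B := (abs_nonneg _).trans (hB 0 0)
  have mV := measurable_Vap hZ l f hf
  have mVp := measurable_Vpath l f hf
  let Φ : (ℝ × ℝ × ℝ) × ℝ → ℝ := fun q => g q.2 q.1.1 * g q.1.2.1 q.1.2.2
  have mg : ∀ {E : Type} [MeasurableSpace E] (u v : E → ℝ), Measurable u → Measurable v →
    Measurable (fun x => g (u x) (v x)) := fun u v hu hv => hg.comp (hu.prodMk hv)
  have hΦ : Measurable Φ := (mg _ _ (by fun_prop) (by fun_prop)).mul
    (mg _ _ (by fun_prop) (by fun_prop))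
  have hΦM : ∀ q, |Φ q| ≤ B ^ 2 := fun q => by
    rw [abs_mul, sq]; exact mul_le_mul (hB _ _) (hB _ _) (abs_nonneg _) hB0
  have tv := tv_path P hX hZ hs hβ s (-(max b (max c d)) - l)
    (fun q => (Vpath l f b q, Vpath l f c q, Vpath l f d q)) (Vpath l f a)
    ((mVp b).prodMk ((mVp c).prodMk (mVp d))) (mVp a)
    (by
      simp only [Vpath_path_shift]
      refine measurable_triple (pastSigma Z) (Vap_past l f hf _ ?_)
        (Vap_past l f hf _ ?_) (Vap_past l f hf _ ?_) <;> omega)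
    (by simp only [Vpath_path_shift]; exact Vap_future l f hf _ _ (by omega))
    Φ hΦ (B ^ 2) hΦM (by positivity)
  simp only [Vpath_path] at tv
  have : IsProbabilityMeasure (P.map (Vap Z l f a)) :=
    Measure.isProbabilityMeasure_map (mV a).aemeasurable
  have : IsProbabilityMeasure (P.map fun ω => (Vap Z l f b ω, Vap Z l f c ω, Vap Z l f d ω)) :=
    Measure.isProbabilityMeasure_map ((mV b).prodMk ((mV c).prodMk (mV d))).aemeasurable
  rw [integral_prod _ (Integrable.of_bound hΦ.aestronglyMeasurable (B ^ 2)
    (Eventually.of_forall hΦM))] at tv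
  simp only [Φ, integral_mul_const] at tv
  rw [law_V P hX hZ hs l f hf a] at tv
  simpa [hdeg] using tv

lemma cov_first {Ω : Type*} [MeasurableSpace Ω]
    (P : Measure Ω) [IsProbabilityMeasure P]
    {X Z : ℤ → Ω → ℝ} (hX : ∀ i, Measurable (X i)) (hZ : ∀ i, Measurable (Z i))
    (hs : IsPairStationary P X Z) {β : ℕ → ℝ} (hβ : IsBetaBound P Z β)
    (l : ℕ) (f : (Fin (2 * l + 1) → ℝ) → ℝ) (hf : Measurable f)
    (g : ℝ → ℝ → ℝ) (hg : Measurable (fun q : ℝ × ℝ => g q.1 q.2)) (B : ℝ)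
    (hB : ∀ x y, |g x y| ≤ B) (hdeg : ∀ y, ∫ x, g x y ∂(P.map (Vap Z l f 0)) = 0)
    (s : ℕ) (a b c d : ℤ) (hb : a + 2 * l + s ≤ b) (hc : a + 2 * l + s ≤ c)
    (hd : a + 2 * l + s ≤ d) :
    |∫ ω, g (Vap Z l f a ω) (Vap Z l f b ω) * g (Vap Z l f c ω) (Vap Z l f d ω) ∂P| ≤
      4 * B ^ 2 * β s := by
  have hB0 : 0 ≤ B := (abs_nonneg _).trans (hB 0 0)
  have mV := measurable_Vap hZ l f hf
  have mVp := measurable_Vpath l f hf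
  let Φ : ℝ × (ℝ × ℝ × ℝ) → ℝ := fun q => g q.1 q.2.1 * g q.2.2.1 q.2.2.2
  have mg : ∀ {E : Type} [MeasurableSpace E] (u v : E → ℝ), Measurable u → Measurable v →
    Measurable (fun x => g (u x) (v x)) := fun u v hu hv => hg.comp (hu.prodMk hv)
  have hΦ : Measurable Φ := (mg _ _ (by fun_prop) (by fun_prop)).mul
    (mg _ _ (by fun_prop) (by fun_prop))
  have hΦM : ∀ q, |Φ q| ≤ B ^ 2 := fun q => by
    rw [abs_mul, sq]; exact mul_le_mul (hB _ _) (hB _ _) (abs_nonneg _) hB0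
  have tv := tv_path P hX hZ hs hβ s (-a - l) (Vpath l f a)
    (fun q => (Vpath l f b q, Vpath l f c q, Vpath l f d q))
    (mVp a) ((mVp b).prodMk ((mVp c).prodMk (mVp d)))
    (by simp only [Vpath_path_shift]; exact Vap_past l f hf _ (by omega))
    (by
      simp only [Vpath_path_shift]
      refine measurable_triple (futureSigma Z s) (Vap_future l f hf _ _ ?_)
        (Vap_future l f hf _ _ ?_) (Vap_future l f hf _ _ ?_) <;> omega)
    Φ hΦ (B ^ 2) hΦM (by positivity)
  simp only [Vpath_path] at tv
  have : IsProbabilityMeasure (P.map (Vap Z l f a)) :=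
    Measure.isProbabilityMeasure_map (mV a).aemeasurable
  have : IsProbabilityMeasure (P.map fun ω => (Vap Z l f b ω, Vap Z l f c ω, Vap Z l f d ω)) :=
    Measure.isProbabilityMeasure_map ((mV b).prodMk ((mV c).prodMk (mV d))).aemeasurable
  rw [integral_prod_symm _ (Integrable.of_bound hΦ.aestronglyMeasurable (B ^ 2)
    (Eventually.of_forall hΦM))] at tv
  simp only [Φ, integral_mul_const] at tv
  rw [law_V P hX hZ hs l f hf a] at tv
  simpa [hdeg] using tv

/-- the covariance envelope -/
def gam (B : ℝ) (β : ℕ → ℝ) (l u : ℕ) : ℝ := B ^ 2 * (if u ≤ 2 * l then 1 else 4 * β (u - 2 * l))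

lemma cov_triv {Ω : Type*} [MeasurableSpace Ω]
    (P : Measure Ω) [IsProbabilityMeasure P]
    {X Z : ℤ → Ω → ℝ} (hX : ∀ i, Measurable (X i)) (hZ : ∀ i, Measurable (Z i))
    (hs : IsPairStationary P X Z) {β : ℕ → ℝ} (hβ : IsBetaBound P Z β)
    (l : ℕ) (f : (Fin (2 * l + 1) → ℝ) → ℝ) (hf : Measurable f)
    (g : ℝ → ℝ → ℝ) (hg : Measurable (fun q : ℝ × ℝ => g q.1 q.2)) (B : ℝ)
    (hB : ∀ x y, |g x y| ≤ B) (hdeg : ∀ y, ∫ x, g x y ∂(P.map (Vap Z l f 0)) = 0)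
    (a b c d : ℤ) :
    |∫ ω, g (Vap Z l f a ω) (Vap Z l f b ω) * g (Vap Z l f c ω) (Vap Z l f d ω) ∂P| ≤ B ^ 2 := by
  have hB0 : 0 ≤ B := (abs_nonneg _).trans (hB 0 0)
  have := norm_integral_le_of_norm_le_const (μ := P) (C := B ^ 2)
    (f := fun ω => g (Vap Z l f a ω) (Vap Z l f b ω) * g (Vap Z l f c ω) (Vap Z l f d ω))
    (Eventually.of_forall fun ω => by
      rw [Real.norm_eq_abs, abs_mul, sq]
      exact mul_le_mul (hB _ _) (hB _ _) (abs_nonneg _) hB0)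
  simpa using this

lemma cov_last_gam {Ω : Type*} [MeasurableSpace Ω]
    (P : Measure Ω) [IsProbabilityMeasure P]
    {X Z : ℤ → Ω → ℝ} (hX : ∀ i, Measurable (X i)) (hZ : ∀ i, Measurable (Z i))
    (hs : IsPairStationary P X Z) {β : ℕ → ℝ} (hβ : IsBetaBound P Z β)
    (l : ℕ) (f : (Fin (2 * l + 1) → ℝ) → ℝ) (hf : Measurable f)
    (g : ℝ → ℝ → ℝ) (hg : Measurable (fun q : ℝ × ℝ => g q.1 q.2)) (B : ℝ)
    (hB : ∀ x y, |g x y| ≤ B) (hdeg : ∀ y, ∫ x, g x y ∂(P.map (Vap Z l f 0)) = 0)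
    (u : ℕ) (a b c d : ℤ) (hb : b + u ≤ a) (hc : c + u ≤ a)
    (hd : d + u ≤ a) :
    |∫ ω, g (Vap Z l f a ω) (Vap Z l f b ω) * g (Vap Z l f c ω) (Vap Z l f d ω) ∂P| ≤
      gam B β l u := by
  unfold gam
  split_ifs with hu
  · rw [mul_one]
    exact cov_triv P hX hZ hs hβ l f hf g hg B hB hdeg a b c d
  · have := cov_last P hX hZ hs hβ l f hf g hg B hB hdeg (u - 2 * l) a b c d
      (by omega) (by omega) (by omega)
    linarith

lemma cov_first_gam {Ω : Type*} [MeasurableSpace Ω]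
    (P : Measure Ω) [IsProbabilityMeasure P]
    {X Z : ℤ → Ω → ℝ} (hX : ∀ i, Measurable (X i)) (hZ : ∀ i, Measurable (Z i))
    (hs : IsPairStationary P X Z) {β : ℕ → ℝ} (hβ : IsBetaBound P Z β)
    (l : ℕ) (f : (Fin (2 * l + 1) → ℝ) → ℝ) (hf : Measurable f)
    (g : ℝ → ℝ → ℝ) (hg : Measurable (fun q : ℝ × ℝ => g q.1 q.2)) (B : ℝ)
    (hB : ∀ x y, |g x y| ≤ B) (hdeg : ∀ y, ∫ x, g x y ∂(P.map (Vap Z l f 0)) = 0)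
    (u : ℕ) (a b c d : ℤ) (hb : a + u ≤ b) (hc : a + u ≤ c)
    (hd : a + u ≤ d) :
    |∫ ω, g (Vap Z l f a ω) (Vap Z l f b ω) * g (Vap Z l f c ω) (Vap Z l f d ω) ∂P| ≤
      gam B β l u := by
  unfold gam
  split_ifs with hu
  · rw [mul_one]
    exact cov_triv P hX hZ hs hβ l f hf g hg B hB hdeg a b c d
  · have := cov_first P hX hZ hs hβ l f hf g hg B hB hdeg (u - 2 * l) a b c d
      (by omega) (by omega) (by omega)
    linarith

lemma cov_gam {Ω : Type*} [MeasurableSpace Ω]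
    (P : Measure Ω) [IsProbabilityMeasure P]
    {X Z : ℤ → Ω → ℝ} (hX : ∀ i, Measurable (X i)) (hZ : ∀ i, Measurable (Z i))
    (hs : IsPairStationary P X Z) {β : ℕ → ℝ} (hβ : IsBetaBound P Z β)
    (l : ℕ) (f : (Fin (2 * l + 1) → ℝ) → ℝ) (hf : Measurable f)
    (g : ℝ → ℝ → ℝ) (hg : Measurable (fun q : ℝ × ℝ => g q.1 q.2)) (B : ℝ)
    (hB : ∀ x y, |g x y| ≤ B) (hdeg : ∀ y, ∫ x, g x y ∂(P.map (Vap Z l f 0)) = 0)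
    (hβ0 : ∀ k, 0 ≤ β k) (hsym : ∀ x y, g x y = g y x) (i j i' j' : ℤ) (hij : i < j)
    (hij' : i' < j') :
    |∫ ω, g (Vap Z l f i ω) (Vap Z l f j ω) * g (Vap Z l f i' ω) (Vap Z l f j' ω) ∂P| ≤
      gam B β l (max (i - j).natAbs (i' - j').natAbs) +
      gam B β l (max (i - i').natAbs (j - j').natAbs) := by
  have g0 : ∀ u, 0 ≤ gam B β l u := fun u => by
    unfold gam; have := hβ0 (u - 2 * l); split_ifs <;> positivity
  have first := cov_first_gam P hX hZ hs hβ l f hf g hg B hB hdeg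
  have last := cov_last_gam P hX hZ hs hβ l f hf g hg B hB hdeg
  set V := Vap Z l f with hV
  have sw : ∀ a b c d : ℤ, ∫ ω, g (V a ω) (V b ω) * g (V c ω) (V d ω) ∂P =
    ∫ ω, g (V c ω) (V d ω) * g (V a ω) (V b ω) ∂P := fun a b c d => by
      congr 1; funext ω; ring
  have fl : ∀ a b c d : ℤ, ∫ ω, g (V a ω) (V b ω) * g (V c ω) (V d ω) ∂P =
    ∫ ω, g (V b ω) (V a ω) * g (V c ω) (V d ω) ∂P := fun a b c d => by
      congr 1; funext ω; rw [hsym (V a ω)]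
  by_cases h1 : j ≤ i' ∨ j' ≤ i
  · refine le_trans ?_ (le_add_of_nonneg_right (g0 _))
    rcases le_total (i - j).natAbs (i' - j').natAbs with hm | hm
    · rw [max_eq_right hm]
      rcases h1 with h1 | h1
      · rw [sw, fl]; exact last _ _ _ _ _ (by omega) (by omega) (by omega)
      · rw [sw]; exact first _ _ _ _ _ (by omega) (by omega) (by omega)
    · rw [max_eq_left hm]
      rcases h1 with h1 | h1
      · exact first _ _ _ _ _ (by omega) (by omega) (by omega)
      · rw [fl]; exact last _ _ _ _ _ (by omega) (by omega) (by omega)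
  · refine le_trans ?_ (le_add_of_nonneg_left (g0 _))
    rcases le_total (i - i').natAbs (j - j').natAbs with hm | hm
    · rw [max_eq_right hm]
      rcases le_total j j' with h2 | h2
      · rw [sw, fl]; exact last _ _ _ _ _ (by omega) (by omega) (by omega)
      · rw [fl]; exact last _ _ _ _ _ (by omega) (by omega) (by omega)
    · rw [max_eq_left hm]
      rcases le_total i i' with h2 | h2
      · exact first _ _ _ _ _ (by omega) (by omega) (by omega)
      · rw [sw]; exact first _ _ _ _ _ (by omega) (by omega) (by omega)


lemma sum_natAbs_le (N : ℕ) (s : Finset ℤ) (hs : s ⊆ Finset.Icc 1 (N : ℤ)) (i : ℤ)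
    (hi : i ∈ Finset.Icc 1 (N : ℤ)) (φ : ℕ → ℝ) (hφ : ∀ u, 0 ≤ φ u) :
    ∑ x ∈ s, φ (i - x).natAbs ≤ 2 * ∑ u ∈ Finset.range N, φ u := by
  have key : ∀ x ∈ s, φ (i - x).natAbs ≤ ∑ u ∈ Finset.range N,
      ((if i - u = x then φ u else 0) + (if i + u = x then φ u else 0)) := by
    intro x hx
    have hx := hs hx
    rw [Finset.mem_Icc] at hx hi
    have hm : (i - x).natAbs ∈ Finset.range N := by rw [Finset.mem_range]; omega
    refine le_trans ?_ (Finset.single_le_sum (f := fun u : ℕ =>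
      ((if i - u = x then φ u else 0) + (if i + u = x then φ u else 0))) ?_ hm)
    · show _ ≤ ((if i - ((i - x).natAbs : ℤ) = x then φ (i - x).natAbs else 0) +
        (if i + ((i - x).natAbs : ℤ) = x then φ (i - x).natAbs else 0))
      have := hφ (i - x).natAbs
      rcases le_total x i with h | h
      · rw [if_pos (by omega)]; split_ifs <;> linarith
      · rw [if_pos (c := i + ((i - x).natAbs : ℤ) = x) (by omega)]; split_ifs <;> linarith
    · intro u _
      have := hφ u
      show 0 ≤ ((if i - (u : ℤ) = x then φ u else 0) + (if i + (u : ℤ) = x then φ u else 0))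
      split_ifs <;> linarith
  refine (Finset.sum_le_sum key).trans ?_
  rw [Finset.sum_comm, Finset.mul_sum]
  refine Finset.sum_le_sum fun u _ => ?_
  rw [Finset.sum_add_distrib, Finset.sum_ite_eq, Finset.sum_ite_eq]
  have := hφ u
  split_ifs <;> linarith

lemma sum_two_le (N : ℕ) (s s' : Finset ℤ) (hs : s ⊆ Finset.Icc 1 (N : ℤ))
    (hs' : s' ⊆ Finset.Icc 1 (N : ℤ)) (i j : ℤ)
    (hi : i ∈ Finset.Icc 1 (N : ℤ)) (hj : j ∈ Finset.Icc 1 (N : ℤ))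
    (γ : ℕ → ℝ) (hγ : ∀ u, 0 ≤ γ u) :
    ∑ x ∈ s, ∑ y ∈ s', γ (max (i - x).natAbs (j - y).natAbs) ≤
      4 * ∑ u ∈ Finset.range N, ∑ v ∈ Finset.range N, γ (max u v) := by
  calc _ ≤ ∑ x ∈ s, 2 * ∑ v ∈ Finset.range N, γ (max (i - x).natAbs v) :=
        Finset.sum_le_sum fun x _ => sum_natAbs_le N s' hs' j hj (fun v => γ (max (i - x).natAbs v))
          fun _ => hγ _
    _ = 2 * ∑ x ∈ s, ∑ v ∈ Finset.range N, γ (max (i - x).natAbs v) := by rw [Finset.mul_sum]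
    _ ≤ 2 * (2 * ∑ u ∈ Finset.range N, ∑ v ∈ Finset.range N, γ (max u v)) := by
        have := sum_natAbs_le N s hs i hi (fun u => ∑ v ∈ Finset.range N, γ (max u v))
          fun _ => Finset.sum_nonneg fun _ _ => hγ _
        linarith
    _ = _ := by ring

lemma sum_max_le (N : ℕ) (γ : ℕ → ℝ) (hγ : ∀ u, 0 ≤ γ u) :
    ∑ u ∈ Finset.range N, ∑ v ∈ Finset.range N, γ (max u v) ≤
      ∑ m ∈ Finset.range N, 2 * ((m : ℝ) + 1) * γ m := by
  have one : ∀ u ∈ Finset.range N, ∑ v ∈ Finset.range N, (if v ≤ u then γ u else 0) ≤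
      ((u : ℝ) + 1) * γ u := by
    intro u _
    rw [← Finset.sum_filter, Finset.sum_const, nsmul_eq_mul]
    refine mul_le_mul_of_nonneg_right ?_ (hγ u)
    have : (Finset.range N).filter (fun v => v ≤ u) ⊆ Finset.range (u + 1) := by
      intro v hv
      rw [Finset.mem_filter] at hv
      rw [Finset.mem_range]; omega
    have := Finset.card_le_card this
    rw [Finset.card_range] at this
    exact_mod_cast this
  calc _ ≤ ∑ u ∈ Finset.range N, ∑ v ∈ Finset.range N,
        ((if v ≤ u then γ u else 0) + (if u ≤ v then γ v else 0)) := by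
        refine Finset.sum_le_sum fun u _ => Finset.sum_le_sum fun v _ => ?_
        have := hγ u
        have := hγ v
        rcases le_total u v with h | h
        · rw [max_eq_right h, if_pos h]; split_ifs <;> linarith
        · rw [max_eq_left h, if_pos h]; split_ifs <;> linarith
    _ = ∑ u ∈ Finset.range N, ∑ v ∈ Finset.range N, (if v ≤ u then γ u else 0) +
        ∑ v ∈ Finset.range N, ∑ u ∈ Finset.range N, (if u ≤ v then γ v else 0) := by
        simp only [Finset.sum_add_distrib]
        congr 1
        exact Finset.sum_comm
    _ ≤ ∑ u ∈ Finset.range N, ((u : ℝ) + 1) * γ u + ∑ u ∈ Finset.range N, ((u : ℝ) + 1) * γ u :=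
        add_le_add (Finset.sum_le_sum one) (Finset.sum_le_sum one)
    _ = _ := by
        rw [← Finset.sum_add_distrib]
        exact Finset.sum_congr rfl fun u _ => by ring

lemma sum_gam_le (N l : ℕ) (hl : 1 ≤ l) (B : ℝ) (β : ℕ → ℝ) (hβ0 : ∀ k, 0 ≤ β k)
    (hsum : Summable fun k : ℕ => (k : ℝ) * β k) :
    ∑ m ∈ Finset.range N, 2 * ((m : ℝ) + 1) * gam B β l m ≤
      B ^ 2 * (18 + 32 * ∑' k : ℕ, (k : ℝ) * β k) * (l : ℝ) ^ 2 := by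
  have g0 : ∀ u, 0 ≤ gam B β l u := fun u => by
    unfold gam; have := hβ0 (u - 2 * l); split_ifs <;> positivity
  have hl' : (1 : ℝ) ≤ l := by exact_mod_cast hl
  set S := ∑' k : ℕ, (k : ℝ) * β k
  have hw0 : ∀ k : ℕ, 0 ≤ (k : ℝ) * β k := fun k => mul_nonneg (by positivity) (hβ0 k)
  have hS0 : 0 ≤ S := tsum_nonneg hw0
  have hw : ∑ x ∈ Finset.range N, ((x + 1 : ℕ) : ℝ) * β (x + 1) ≤ S := by
    have := hsum.sum_le_tsum (Finset.range (N + 1)) (fun i _ => hw0 i)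
    rw [Finset.sum_range_succ'] at this
    simpa using this
  calc _ ≤ ∑ m ∈ Finset.range (2 * l + 1 + N), 2 * ((m : ℝ) + 1) * gam B β l m := by
        refine Finset.sum_le_sum_of_subset_of_nonneg (Finset.range_mono (by omega)) fun m _ _ => ?_
        have := g0 m
        positivity
    _ = ∑ m ∈ Finset.range (2 * l + 1), 2 * ((m : ℝ) + 1) * gam B β l m +
        ∑ x ∈ Finset.range N, 2 * (((2 * l + 1 + x : ℕ) : ℝ) + 1) * gam B β l (2 * l + 1 + x) := by
        rw [Finset.sum_range_add]
    _ ≤ ∑ m ∈ Finset.range (2 * l + 1), 2 * (2 * (l : ℝ) + 1) * B ^ 2 +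
        ∑ x ∈ Finset.range N, 32 * l * B ^ 2 * (((x + 1 : ℕ) : ℝ) * β (x + 1)) := by
        refine add_le_add (Finset.sum_le_sum fun m hm => ?_) (Finset.sum_le_sum fun x _ => ?_)
        · rw [Finset.mem_range] at hm
          rw [gam, if_pos (by omega), mul_one]
          have : (m : ℝ) ≤ 2 * l := by exact_mod_cast (by omega : m ≤ 2 * l)
          gcongr
        · rw [gam, if_neg (by omega), show 2 * l + 1 + x - 2 * l = x + 1 by omega]
          have hb := hβ0 (x + 1)
          have : 2 * (((2 * l + 1 + x : ℕ) : ℝ) + 1) * 4 ≤ 32 * l * ((x + 1 : ℕ) : ℝ) := by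
            push_cast
            have hx : (0 : ℝ) ≤ x := by positivity
            nlinarith [mul_nonneg hx (sub_nonneg.2 hl')]
          calc _ = (2 * (((2 * l + 1 + x : ℕ) : ℝ) + 1) * 4) * (B ^ 2 * β (x + 1)) := by ring
            _ ≤ (32 * l * ((x + 1 : ℕ) : ℝ)) * (B ^ 2 * β (x + 1)) := by gcongr
            _ = _ := by ring
    _ ≤ 18 * (l : ℝ) ^ 2 * B ^ 2 + 32 * (l : ℝ) ^ 2 * B ^ 2 * S := by
        rw [Finset.sum_const, Finset.card_range, nsmul_eq_mul]
        refine add_le_add ?_ ?_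
        · push_cast
          have : (2 * (l : ℝ) + 1) * (2 * (2 * (l : ℝ) + 1)) ≤ 18 * (l : ℝ) ^ 2 := by nlinarith
          nlinarith [sq_nonneg B]
        · have : (l : ℝ) ≤ (l : ℝ) ^ 2 := by nlinarith
          rw [← Finset.mul_sum]
          exact mul_le_mul (by gcongr) hw
            (Finset.sum_nonneg fun x _ => mul_nonneg (by positivity) (hβ0 _)) (by positivity)
    _ = _ := by ring

lemma sum_four_le (N : ℕ) (a b : ℕ) (hab : a ≤ b) (hb : b ≤ N) (γ : ℕ → ℝ) (hγ : ∀ u, 0 ≤ γ u)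
    (c : ℤ → ℤ → ℤ → ℤ → ℝ)
    (hc : ∀ i j i' j', i < j → i' < j' → c i j i' j' ≤
      γ (max (i - j).natAbs (i' - j').natAbs) + γ (max (i - i').natAbs (j - j').natAbs)) :
    ∑ j ∈ Finset.Ioc (a : ℤ) b, ∑ i ∈ Finset.Ico 1 j,
      ∑ j' ∈ Finset.Ioc (a : ℤ) b, ∑ i' ∈ Finset.Ico 1 j', c i j i' j' ≤
    8 * N * ((b : ℝ) - a) * ∑ u ∈ Finset.range N, ∑ v ∈ Finset.range N, γ (max u v) := by
  set S := ∑ u ∈ Finset.range N, ∑ v ∈ Finset.range N, γ (max u v)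
  have hS : 0 ≤ S := Finset.sum_nonneg fun _ _ => Finset.sum_nonneg fun _ _ => hγ _
  let I := Finset.Icc 1 (N : ℤ)
  let J := Finset.Ioc (a : ℤ) b
  have hJI : J ⊆ I := fun x hx => by
    simp only [J, I, Finset.mem_Ioc, Finset.mem_Icc] at *; omega
  have hsub : ∀ j ∈ J, Finset.Ico 1 j ⊆ I := fun j hj x hx => by
    simp only [J, I, Finset.mem_Ioc, Finset.mem_Icc, Finset.mem_Ico] at *; omega
  have cI : (I.card : ℝ) = N := by simp [I]
  have cJ : (J.card : ℝ) = (b : ℝ) - a := by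
    simp only [J, Int.card_Ioc]
    rw [show ((b : ℤ) - a).toNat = b - a by omega, Nat.cast_sub hab]
  let p1 : ℤ → ℤ → ℤ → ℤ → ℝ := fun i j i' j' => γ (max (i - j).natAbs (i' - j').natAbs)
  let p2 : ℤ → ℤ → ℤ → ℤ → ℝ := fun i j i' j' => γ (max (i - i').natAbs (j - j').natAbs)
  have hp1 : ∀ i j i' j', 0 ≤ p1 i j i' j' := fun _ _ _ _ => hγ _
  have hp2 : ∀ i j i' j', 0 ≤ p2 i j i' j' := fun _ _ _ _ => hγ _
  have big : ∀ p : ℤ → ℤ → ℤ → ℤ → ℝ, (∀ i j i' j', 0 ≤ p i j i' j') →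
      ∑ j ∈ J, ∑ i ∈ Finset.Ico 1 j, ∑ j' ∈ J, ∑ i' ∈ Finset.Ico 1 j', p i j i' j' ≤
      ∑ j ∈ J, ∑ i ∈ I, ∑ j' ∈ J, ∑ i' ∈ I, p i j i' j' := by
    intro p hp
    refine Finset.sum_le_sum fun j hj => ?_
    calc _ ≤ ∑ i ∈ Finset.Ico 1 j, ∑ j' ∈ J, ∑ i' ∈ I, p i j i' j' :=
          Finset.sum_le_sum fun i _ => Finset.sum_le_sum fun j' hj' =>
            Finset.sum_le_sum_of_subset_of_nonneg (hsub j' hj') fun _ _ _ => hp _ _ _ _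
      _ ≤ _ := Finset.sum_le_sum_of_subset_of_nonneg (hsub j hj) fun _ _ _ =>
          Finset.sum_nonneg fun _ _ => Finset.sum_nonneg fun _ _ => hp _ _ _ _
  have b1 : ∑ j ∈ J, ∑ i ∈ I, ∑ j' ∈ J, ∑ i' ∈ I, p1 i j i' j' ≤ 4 * N * ((b : ℝ) - a) * S := by
    calc _ = ∑ j ∈ J, ∑ j' ∈ J, ∑ i ∈ I, ∑ i' ∈ I, γ (max (j - i).natAbs (j' - i').natAbs) := by
          refine Finset.sum_congr rfl fun j _ => ?_
          rw [Finset.sum_comm]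
          refine Finset.sum_congr rfl fun j' _ => Finset.sum_congr rfl fun i _ =>
            Finset.sum_congr rfl fun i' _ => ?_
          simp only [p1]
          rw [← Int.natAbs_neg (i - j), ← Int.natAbs_neg (i' - j'), neg_sub, neg_sub]
      _ ≤ ∑ j ∈ J, ∑ j' ∈ J, 4 * S := Finset.sum_le_sum fun j hj => Finset.sum_le_sum fun j' hj' =>
          sum_two_le N I I subset_rfl subset_rfl j j' (hJI hj) (hJI hj') γ hγ
      _ = ((b : ℝ) - a) * (((b : ℝ) - a) * (4 * S)) := by
          simp only [Finset.sum_const, nsmul_eq_mul, cJ]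
      _ ≤ ((b : ℝ) - a) * (N * (4 * S)) := by
          have h1 : (a : ℝ) ≤ b := by exact_mod_cast hab
          have h2 : (b : ℝ) ≤ N := by exact_mod_cast hb
          have h3 : (0 : ℝ) ≤ a := by positivity
          refine mul_le_mul_of_nonneg_left (mul_le_mul_of_nonneg_right ?_ (by positivity)) ?_ <;>
            linarith
      _ = _ := by ring
  have b2 : ∑ j ∈ J, ∑ i ∈ I, ∑ j' ∈ J, ∑ i' ∈ I, p2 i j i' j' ≤ 4 * N * ((b : ℝ) - a) * S := by
    calc _ ≤ ∑ j ∈ J, ∑ i ∈ I, 4 * S := Finset.sum_le_sum fun j hj =>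
          Finset.sum_le_sum fun i hi => by
            rw [Finset.sum_comm]
            exact sum_two_le N I J subset_rfl hJI i j hi (hJI hj) γ hγ
      _ = ((b : ℝ) - a) * (N * (4 * S)) := by
          simp only [Finset.sum_const, nsmul_eq_mul, cJ, cI]
      _ = _ := by ring
  calc _ ≤ ∑ j ∈ J, ∑ i ∈ Finset.Ico 1 j, ∑ j' ∈ J, ∑ i' ∈ Finset.Ico 1 j',
        (p1 i j i' j' + p2 i j i' j') := by
        refine Finset.sum_le_sum fun j _ => Finset.sum_le_sum fun i hi =>
          Finset.sum_le_sum fun j' _ => Finset.sum_le_sum fun i' hi' => ?_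
        rw [Finset.mem_Ico] at hi hi'
        exact hc _ _ _ _ hi.2 hi'.2
    _ ≤ ∑ j ∈ J, ∑ i ∈ I, ∑ j' ∈ J, ∑ i' ∈ I, (p1 i j i' j' + p2 i j i' j') :=
        big _ fun i j i' j' => add_nonneg (hp1 _ _ _ _) (hp2 _ _ _ _)
    _ = ∑ j ∈ J, ∑ i ∈ I, ∑ j' ∈ J, ∑ i' ∈ I, p1 i j i' j' +
        ∑ j ∈ J, ∑ i ∈ I, ∑ j' ∈ J, ∑ i' ∈ I, p2 i j i' j' := by
        simp only [Finset.sum_add_distrib]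
    _ ≤ _ := by linarith

lemma lint_of_eL2 {Ω : Type*} [MeasurableSpace Ω] (P : Measure Ω) (g : Ω → ℝ) (c : ℝ) (hc : 0 ≤ c)
    (h : eLpNorm g 2 P ≤ ENNReal.ofReal c) :
    ∫⁻ ω, ENNReal.ofReal (g ω ^ 2) ∂P ≤ ENNReal.ofReal (c ^ 2) := by
  rw [eLpNorm_eq_lintegral_rpow_enorm_toReal (by norm_num) (by norm_num)] at h
  have e : ∀ ω, ‖g ω‖ₑ ^ (2 : ℝ≥0∞).toReal = ENNReal.ofReal (g ω ^ 2) := by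
    intro ω
    rw [Real.enorm_eq_ofReal_abs, ENNReal.ofReal_rpow_of_nonneg (abs_nonneg _) (by norm_num)]
    simp
  simp only [e] at h
  have h' := pow_le_pow_left₀ (zero_le) h 2
  rw [← ENNReal.ofReal_pow hc, ← ENNReal.rpow_natCast, ← ENNReal.rpow_mul] at h'
  simpa using h'

lemma eL2_max {Ω : Type*} [MeasurableSpace Ω] (P : Measure Ω) (A B : Ω → ℝ) (hA : Measurable A)
    (c : ℝ) (hc : 0 ≤ c)
    (h1 : eLpNorm A 2 P ≤ ENNReal.ofReal c) (h2 : eLpNorm B 2 P ≤ ENNReal.ofReal c) :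
    eLpNorm (fun ω => max (A ω) (B ω)) 2 P ≤ ENNReal.ofReal (√2 * c) := by
  refine eL2_le P _ _ (by positivity) ?_
  calc _ ≤ ∫⁻ ω, ENNReal.ofReal (A ω ^ 2) + ENNReal.ofReal (B ω ^ 2) ∂P := by
        refine lintegral_mono fun ω => ?_
        rcases le_total (A ω) (B ω) with h | h
        · simp only [max_eq_right h]; exact le_add_self
        · simp only [max_eq_left h]; exact le_self_add
    _ = ∫⁻ ω, ENNReal.ofReal (A ω ^ 2) ∂P + ∫⁻ ω, ENNReal.ofReal (B ω ^ 2) ∂P :=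
        lintegral_add_left (hA.pow_const 2).ennreal_ofReal _
    _ ≤ ENNReal.ofReal (c ^ 2) + ENNReal.ofReal (c ^ 2) :=
        add_le_add (lint_of_eL2 P A c hc h1) (lint_of_eL2 P B c hc h2)
    _ = _ := by
        rw [← ENNReal.ofReal_add (by positivity) (by positivity), mul_pow, Real.sq_sqrt (by norm_num)]
        congr 1; ring

/-- dyadic majorant of the maximum -/
def Mx {Ω : Type*} (T : ℕ → Ω → ℝ) : ℕ → ℕ → Ω → ℝ
  | 0, a => fun ω => |T (a + 1) ω - T a ω|
  | d + 1, a => fun ω => |T (a + 2 ^ d) ω - T a ω| + max (Mx T d a ω) (Mx T d (a + 2 ^ d) ω)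

lemma le_Mx {Ω : Type*} (T : ℕ → Ω → ℝ) (ω : Ω) : ∀ d a n, n ≤ 2 ^ d →
    |T (a + n) ω - T a ω| ≤ Mx T d a ω
  | 0, a, n, hn => by
    simp only [Mx]
    have : n = 0 ∨ n = 1 := by simp at hn; omega
    rcases this with rfl | rfl
    · simp
    · exact le_rfl
  | d + 1, a, n, hn => by
    simp only [Mx]
    rcases le_total n (2 ^ d) with h | h
    · have := le_Mx T ω d a n h
      have := le_max_left (Mx T d a ω) (Mx T d (a + 2 ^ d) ω)
      have := abs_nonneg (T (a + 2 ^ d) ω - T a ω)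
      linarith
    · have h1 := le_Mx T ω d (a + 2 ^ d) (n - 2 ^ d) (by rw [pow_succ] at hn; omega)
      rw [show a + 2 ^ d + (n - 2 ^ d) = a + n by omega] at h1
      have := le_max_right (Mx T d a ω) (Mx T d (a + 2 ^ d) ω)
      have := abs_sub_le (T (a + n) ω) (T (a + 2 ^ d) ω) (T a ω)
      linarith

lemma measurable_Mx {Ω : Type*} [MeasurableSpace Ω] (T : ℕ → Ω → ℝ) (hT : ∀ n, Measurable (T n)) :
    ∀ d a, Measurable (Mx T d a)
  | 0, a => by simp only [Mx]; exact ((hT _).sub (hT _)).abs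
  | d + 1, a => by
    simp only [Mx]
    exact ((hT _).sub (hT _)).abs.add ((measurable_Mx T hT d a).max (measurable_Mx T hT d _))

lemma Mx_bound {Ω : Type*} [MeasurableSpace Ω] (P : Measure Ω) (T : ℕ → Ω → ℝ)
    (hT : ∀ n, Measurable (T n)) (N : ℕ) (κ : ℝ) (hκ : 0 ≤ κ)
    (hinc : ∀ a b, a ≤ b → b ≤ N →
      eLpNorm (fun ω => T b ω - T a ω) 2 P ≤ ENNReal.ofReal (κ * √((b : ℝ) - a))) :
    ∀ d a, a + 2 ^ d ≤ N → eLpNorm (Mx T d a) 2 P ≤ ENNReal.ofReal (((d : ℝ) + 1) * κ * √(2 ^ d))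
  | 0, a, h => by
    have := hinc a (a + 1) (by omega) (by simpa using h)
    simp only [Mx]
    refine (le_of_eq ?_).trans (this.trans (le_of_eq ?_))
    · exact eLpNorm_norm (fun ω => T (a + 1) ω - T a ω)
    · simp
  | d + 1, a, h => by
    have hp := Nat.two_pow_pos d
    have h' : a + 2 ^ d + 2 ^ d ≤ N := by rw [pow_succ] at h; omega
    have i1 := hinc a (a + 2 ^ d) (by omega) (by omega)
    have i2 := Mx_bound P T hT N κ hκ hinc d a (by omega)
    have i3 := Mx_bound P T hT N κ hκ hinc d (a + 2 ^ d) h'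
    have i4 := eL2_max P _ _ (measurable_Mx T hT d a) _ (by positivity) i2 i3
    have i1' : eLpNorm (fun ω => |T (a + 2 ^ d) ω - T a ω|) 2 P ≤ ENNReal.ofReal (κ * √(2 ^ d)) := by
      refine (le_of_eq (eLpNorm_norm (fun ω => T (a + 2 ^ d) ω - T a ω))).trans
        (i1.trans (le_of_eq ?_))
      push_cast
      congr 3; ring
    have s := eLpNorm_add_le (μ := P) (p := 2)
      (f := fun ω => |T (a + 2 ^ d) ω - T a ω|)
      (g := fun ω => max (Mx T d a ω) (Mx T d (a + 2 ^ d) ω))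
      ((hT _).sub (hT _)).abs.aestronglyMeasurable
      ((measurable_Mx T hT d a).max (measurable_Mx T hT d _)).aestronglyMeasurable (by norm_num)
    refine s.trans ((add_le_add i1' i4).trans ?_)
    rw [← ENNReal.ofReal_add (by positivity) (by positivity)]
    apply ENNReal.ofReal_le_ofReal
    rw [pow_succ, Real.sqrt_mul (by positivity)]
    push_cast
    have h2 : 1 ≤ √2 := by rw [Real.one_le_sqrt]; norm_num
    have h3 : 0 ≤ κ * √(2 ^ d) := by positivity
    nlinarith [mul_le_mul_of_nonneg_left h2 h3]

/-- the partial sums of the degenerate part -/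
def Tsum {Ω : Type*} (V : ℤ → Ω → ℝ) (g : ℝ → ℝ → ℝ) (n : ℕ) (ω : Ω) : ℝ :=
  ∑ j ∈ Finset.Ioc (0 : ℤ) n, ∑ i ∈ Finset.Ico 1 j, g (V i ω) (V j ω)

lemma Tsum_sub {Ω : Type*} (V : ℤ → Ω → ℝ) (g : ℝ → ℝ → ℝ) (a b : ℕ) (hab : a ≤ b) (ω : Ω) :
    Tsum V g b ω - Tsum V g a ω =
      ∑ j ∈ Finset.Ioc (a : ℤ) b, ∑ i ∈ Finset.Ico 1 j, g (V i ω) (V j ω) := by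
  unfold Tsum
  have h1 : Finset.Ioc (0 : ℤ) b = Finset.Ioc (0 : ℤ) a ∪ Finset.Ioc (a : ℤ) b :=
    (Finset.Ioc_union_Ioc_eq_Ioc (by positivity) (by exact_mod_cast hab)).symm
  rw [h1, Finset.sum_union]
  · ring
  · rw [Finset.disjoint_left]
    intro x hx hx'
    rw [Finset.mem_Ioc] at hx hx'
    omega

lemma Tsum_eq {Ω : Type*} (V : ℤ → Ω → ℝ) (g : ℝ → ℝ → ℝ) (n : ℕ) (ω : Ω) :
    ∑ i ∈ Finset.Icc (1 : ℤ) n, ∑ j ∈ Finset.Ioc i (n : ℤ), g (V i ω) (V j ω) = Tsum V g n ω := by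
  unfold Tsum
  refine Finset.sum_comm' fun i j => ?_
  simp only [Finset.mem_Icc, Finset.mem_Ioc, Finset.mem_Ico]
  omega

lemma measurable_Tsum {Ω : Type*} [MeasurableSpace Ω]
    (P : Measure Ω) [IsProbabilityMeasure P]
    {X Z : ℤ → Ω → ℝ} (hX : ∀ i, Measurable (X i)) (hZ : ∀ i, Measurable (Z i))
    (hs : IsPairStationary P X Z) {β : ℕ → ℝ} (hβ : IsBetaBound P Z β)
    (hβ0 : ∀ k, 0 ≤ β k) (hsum : Summable fun k : ℕ => (k : ℝ) * β k)
    (l : ℕ) (hl : 1 ≤ l) (f : (Fin (2 * l + 1) → ℝ) → ℝ) (hf : Measurable f)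
    (g : ℝ → ℝ → ℝ) (hg : Measurable (fun q : ℝ × ℝ => g q.1 q.2)) (B : ℝ)
    (hB : ∀ x y, |g x y| ≤ B) (hdeg : ∀ y, ∫ x, g x y ∂(P.map (Vap Z l f 0)) = 0)
    (hsym : ∀ x y, g x y = g y x)
    (n : ℕ) : Measurable (Tsum (Vap Z l f) g n) := by
  have mV := measurable_Vap hZ l f hf
  unfold Tsum
  exact Finset.measurable_sum _ fun j _ => Finset.measurable_sum _ fun i _ =>
    hg.comp ((mV i).prodMk (mV j))

lemma Tsum_inc {Ω : Type*} [MeasurableSpace Ω]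
    (P : Measure Ω) [IsProbabilityMeasure P]
    {X Z : ℤ → Ω → ℝ} (hX : ∀ i, Measurable (X i)) (hZ : ∀ i, Measurable (Z i))
    (hs : IsPairStationary P X Z) {β : ℕ → ℝ} (hβ : IsBetaBound P Z β)
    (hβ0 : ∀ k, 0 ≤ β k) (hsum : Summable fun k : ℕ => (k : ℝ) * β k)
    (l : ℕ) (hl : 1 ≤ l) (f : (Fin (2 * l + 1) → ℝ) → ℝ) (hf : Measurable f)
    (g : ℝ → ℝ → ℝ) (hg : Measurable (fun q : ℝ × ℝ => g q.1 q.2)) (B : ℝ)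
    (hB : ∀ x y, |g x y| ≤ B) (hdeg : ∀ y, ∫ x, g x y ∂(P.map (Vap Z l f 0)) = 0)
    (hsym : ∀ x y, g x y = g y x)
    (N a b : ℕ) (hab : a ≤ b) (hbN : b ≤ N) :
    eLpNorm (fun ω => Tsum (Vap Z l f) g b ω - Tsum (Vap Z l f) g a ω) 2 P ≤
      ENNReal.ofReal (√(8 * N * (B ^ 2 * (18 + 32 * ∑' k : ℕ, (k : ℝ) * β k) * (l : ℝ) ^ 2)) *
        √((b : ℝ) - a)) := by
  have mV := measurable_Vap hZ l f hf
  have hB0 : 0 ≤ B := (abs_nonneg _).trans (hB 0 0)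
  have cov := cov_gam P hX hZ hs hβ l f hf g hg B hB hdeg hβ0 hsym
  have g0 : ∀ u, 0 ≤ gam B β l u := fun u => by
    unfold gam; have := hβ0 (u - 2 * l); split_ifs <;> positivity
  set V := Vap Z l f with hV
  have hS0 : 0 ≤ ∑' k : ℕ, (k : ℝ) * β k :=
    tsum_nonneg fun k => mul_nonneg (by positivity) (hβ0 k)
  set S := ∑' k : ℕ, (k : ℝ) * β k with hS
  have hba : (0 : ℝ) ≤ (b : ℝ) - a := by
    have : (a : ℝ) ≤ b := by exact_mod_cast hab
    linarith
  refine eL2_le P _ _ (by positivity) ?_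
  rw [mul_pow, Real.sq_sqrt (by positivity), Real.sq_sqrt hba]
  simp only [Tsum_sub V g a b hab]
  have mG : ∀ i j, Measurable (fun ω => g (V i ω) (V j ω)) := fun i j =>
    hg.comp ((mV i).prodMk (mV j))
  have exp : ∀ ω, (∑ j ∈ Finset.Ioc (a : ℤ) b, ∑ i ∈ Finset.Ico 1 j, g (V i ω) (V j ω)) ^ 2 =
      ∑ j ∈ Finset.Ioc (a : ℤ) b, ∑ i ∈ Finset.Ico 1 j,
        ∑ j' ∈ Finset.Ioc (a : ℤ) b, ∑ i' ∈ Finset.Ico 1 j',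
          g (V i ω) (V j ω) * g (V i' ω) (V j' ω) := by
    intro ω
    rw [sq, Finset.sum_mul]
    refine Finset.sum_congr rfl fun j _ => ?_
    rw [Finset.sum_mul]
    refine Finset.sum_congr rfl fun i _ => ?_
    rw [Finset.mul_sum]
    refine Finset.sum_congr rfl fun j' _ => ?_
    rw [Finset.mul_sum]
  have iG : ∀ i j i' j', Integrable (fun ω => g (V i ω) (V j ω) * g (V i' ω) (V j' ω)) P :=
    fun i j i' j' => Integrable.of_bound ((mG i j).mul (mG i' j')).aestronglyMeasurable (B ^ 2)
      (Eventually.of_forall fun ω => by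
        rw [Real.norm_eq_abs, abs_mul, sq]
        exact mul_le_mul (hB _ _) (hB _ _) (abs_nonneg _) hB0)
  have iS3 : ∀ i j j', Integrable (fun ω => ∑ i' ∈ Finset.Ico 1 j',
      g (V i ω) (V j ω) * g (V i' ω) (V j' ω)) P := fun i j j' =>
    integrable_finsetSum _ fun i' _ => iG _ _ _ _
  have iS2 : ∀ i j, Integrable (fun ω => ∑ j' ∈ Finset.Ioc (a : ℤ) b, ∑ i' ∈ Finset.Ico 1 j',
      g (V i ω) (V j ω) * g (V i' ω) (V j' ω)) P := fun i j =>
    integrable_finsetSum _ fun i' _ => iS3 _ _ _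
  have iS1 : ∀ j, Integrable (fun ω => ∑ i ∈ Finset.Ico 1 j,
      ∑ j' ∈ Finset.Ioc (a : ℤ) b, ∑ i' ∈ Finset.Ico 1 j',
      g (V i ω) (V j ω) * g (V i' ω) (V j' ω)) P := fun j =>
    integrable_finsetSum _ fun i' _ => iS2 _ _
  have iS0 : Integrable (fun ω => ∑ j ∈ Finset.Ioc (a : ℤ) b, ∑ i ∈ Finset.Ico 1 j,
      ∑ j' ∈ Finset.Ioc (a : ℤ) b, ∑ i' ∈ Finset.Ico 1 j',
      g (V i ω) (V j ω) * g (V i' ω) (V j' ω)) P :=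
    integrable_finsetSum _ fun i' _ => iS1 _
  rw [← ofReal_integral_eq_lintegral_ofReal (by simp only [exp]; exact iS0)
    (Eventually.of_forall fun ω => sq_nonneg _)]
  apply ENNReal.ofReal_le_ofReal
  simp only [exp]
  rw [integral_finsetSum _ fun j _ => iS1 j]
  simp only [integral_finsetSum _ fun i _ => iS2 i _, integral_finsetSum _ fun j' _ => iS3 _ _ j',
    integral_finsetSum _ fun i' _ => iG _ _ i' _]
  refine (sum_four_le N a b hab hbN (gam B β l) g0
    (fun i j i' j' => ∫ ω, g (V i ω) (V j ω) * g (V i' ω) (V j' ω) ∂P)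
    fun i j i' j' h1 h2 => (le_abs_self _).trans (cov i j i' j' h1 h2)).trans ?_
  have := (sum_max_le N _ g0).trans (sum_gam_le N l hl B β hβ0 hsum)
  calc _ ≤ 8 * N * ((b : ℝ) - a) * (B ^ 2 * (18 + 32 * S) * (l : ℝ) ^ 2) :=
        mul_le_mul_of_nonneg_left this (by positivity)
    _ = _ := by ring


lemma pned_delta {Ω : Type*} [MeasurableSpace Ω] (P : Measure Ω) [IsProbabilityMeasure P]
    (X Z : ℤ → Ω → ℝ) (a : ℕ → ℝ) (φ : ℝ → ℝ)
    (hO : (fun l : ℕ => a l * φ ((l : ℝ) ^ (-6 : ℤ))) =O[atTop] fun l : ℕ => (l : ℝ) ^ (-6 : ℤ))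
    (f : (l : ℕ) → ((Fin (2 * l + 1) → ℝ) → ℝ))
    (hf : ∀ (l : ℕ), ∀ ε > (0 : ℝ),
        (P {ω | ε < |X 0 ω - f l fun i => Z (((i : ℕ) : ℤ) - (l : ℤ)) ω|}).toReal ≤ a l * φ ε) :
    ∃ Cδ : ℝ, 0 ≤ Cδ ∧ ∀ l : ℕ, 1 ≤ l →
      P {ω | (l : ℝ) ^ (-6 : ℤ) < |X 0 ω - Vap Z l (f l) 0 ω|} ≤
        ENNReal.ofReal (Cδ * (l : ℝ) ^ (-6 : ℤ)) := by
  obtain ⟨K, hK⟩ := hO.bound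
  obtain ⟨l0, hl0⟩ := eventually_atTop.1 hK
  refine ⟨max K 0 + (l0 : ℝ) ^ 6, by positivity, fun l hl => ?_⟩
  have hlp : (0 : ℝ) < l := by exact_mod_cast hl
  have hε : (0 : ℝ) < (l : ℝ) ^ (-6 : ℤ) := by positivity
  rw [ENNReal.le_ofReal_iff_toReal_le (measure_ne_top _ _) (by positivity)]
  rcases le_total l0 l with h | h
  · have h1 := hf l _ hε
    have h2 := hl0 l h
    rw [Real.norm_eq_abs, Real.norm_eq_abs, abs_of_pos hε] at h2
    have h3 : (P {ω | (l : ℝ) ^ (-6 : ℤ) < |X 0 ω - Vap Z l (f l) 0 ω|}).toReal ≤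
        a l * φ ((l : ℝ) ^ (-6 : ℤ)) := by
      simpa [Vap] using h1
    refine h3.trans ((le_abs_self _).trans (h2.trans ?_))
    refine mul_le_mul_of_nonneg_right ?_ hε.le
    have := le_max_left K 0
    have : (0 : ℝ) ≤ (l0 : ℝ) ^ 6 := by positivity
    linarith
  · have h1 : (P {ω | (l : ℝ) ^ (-6 : ℤ) < |X 0 ω - Vap Z l (f l) 0 ω|}).toReal ≤ 1 := by
      have := ENNReal.toReal_mono ENNReal.one_ne_top (prob_le_one (μ := P)
        (s := {ω | (l : ℝ) ^ (-6 : ℤ) < |X 0 ω - Vap Z l (f l) 0 ω|}))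
      simpa using this
    refine h1.trans ?_
    have h2 : (1 : ℝ) = (l : ℝ) ^ 6 * (l : ℝ) ^ (-6 : ℤ) := by
      rw [zpow_neg]
      exact_mod_cast (mul_inv_cancel₀ (by positivity : (l : ℝ) ^ 6 ≠ 0)).symm
    rw [h2]
    refine mul_le_mul_of_nonneg_right ?_ hε.le
    have : (l : ℝ) ^ 6 ≤ (l0 : ℝ) ^ 6 := by gcongr
    have := le_max_right K 0
    linarith

lemma sum_sqrt_beta (β : ℕ → ℝ) (hβ0 : ∀ k, 0 ≤ β k)
    (hsum : Summable fun k : ℕ => (k : ℝ) * β k) (N : ℕ) :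
    2 * ∑ x ∈ Finset.range N, √(β (x + 1)) ≤ 1 + Real.log N + ∑' k : ℕ, (k : ℝ) * β k := by
  have hw0 : ∀ k : ℕ, 0 ≤ (k : ℝ) * β k := fun k => mul_nonneg (by positivity) (hβ0 k)
  have hw : ∑ x ∈ Finset.range N, ((x + 1 : ℕ) : ℝ) * β (x + 1) ≤ ∑' k : ℕ, (k : ℝ) * β k := by
    have := hsum.sum_le_tsum (Finset.range (N + 1)) (fun i _ => hw0 i)
    rw [Finset.sum_range_succ'] at this
    simpa using this
  have hh : ∑ x ∈ Finset.range N, (((x + 1 : ℕ) : ℝ))⁻¹ ≤ 1 + Real.log N := by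
    have := harmonic_le_one_add_log N
    simpa [harmonic] using this
  rw [Finset.mul_sum]
  refine le_trans ?_ (add_le_add hh hw)
  rw [← Finset.sum_add_distrib]
  refine Finset.sum_le_sum fun x _ => ?_
  set y : ℝ := ((x + 1 : ℕ) : ℝ) with hy
  have hy0 : 0 < y := by rw [hy]; positivity
  have e : β (x + 1) = √(β (x + 1)) ^ 2 := (Real.sq_sqrt (hβ0 _)).symm
  set r := √(β (x + 1))
  rw [e]
  have h1 : 0 ≤ y⁻¹ * (y * r - 1) ^ 2 := by positivity
  have h2 : y⁻¹ * (y * r - 1) ^ 2 = y⁻¹ + y * r ^ 2 - 2 * r := by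
    field_simp
    ring
  linarith

lemma D_total {Ω : Type*} [MeasurableSpace Ω] (P : Measure Ω) [IsProbabilityMeasure P]
    (D : ℤ → ℤ → Ω → ℝ) (mD : ∀ i j, Measurable (D i j)) (M : ℝ) (hM0 : 0 ≤ M)
    (hD : ∀ i j ω, |D i j ω| ≤ 4 * M) (β : ℕ → ℝ) (hβ0 : ∀ k, 0 ≤ β k)
    (hsum : Summable fun k : ℕ => (k : ℝ) * β k) (l : ℕ) (r : ℝ) (hr : 0 ≤ r)
    (hfar : ∀ (s : ℕ) (i j : ℤ), i + 2 * l + s ≤ j →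
      eLpNorm (D i j) 2 P ≤ ENNReal.ofReal (4 * r + 2 * M * √(β s))) (N : ℕ) :
    eLpNorm (fun ω => ∑ i ∈ Finset.Icc (1 : ℤ) N, ∑ j ∈ Finset.Ioc i (N : ℤ), |D i j ω|) 2 P ≤
      ENNReal.ofReal (2 * N * ((2 * l + 1) * (4 * M) + N * (4 * r) +
        M * (1 + Real.log N + ∑' k : ℕ, (k : ℝ) * β k))) := by
  let ρ : ℕ → ℝ := fun u => if u ≤ 2 * l then 4 * M else 4 * r + 2 * M * √(β (u - 2 * l))
  have hρ0 : ∀ u, 0 ≤ ρ u := fun u => by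
    simp only [ρ]; split_ifs <;> positivity
  have one : ∀ i j : ℤ, i < j → eLpNorm (fun ω => |D i j ω|) 2 P ≤ ENNReal.ofReal (ρ (i - j).natAbs) := by
    intro i j hij
    refine (le_of_eq (eLpNorm_norm (D i j))).trans ?_
    simp only [ρ]
    split_ifs with h
    · have := eLpNorm_le_of_ae_bound (p := 2) (μ := P) (f := D i j) (C := 4 * M)
        (Eventually.of_forall fun ω => hD i j ω)
      simpa using this
    · exact hfar _ i j (by omega)
  have mA : ∀ i j, AEStronglyMeasurable (fun ω => |D i j ω|) P := fun i j =>
    (mD i j).abs.aestronglyMeasurable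
  have e : (fun ω => ∑ i ∈ Finset.Icc (1 : ℤ) N, ∑ j ∈ Finset.Ioc i (N : ℤ), |D i j ω|) =
      ∑ i ∈ Finset.Icc (1 : ℤ) N, ∑ j ∈ Finset.Ioc i (N : ℤ), fun ω => |D i j ω| := by
    funext ω; simp only [Finset.sum_apply]
  rw [e]
  calc _ ≤ ∑ i ∈ Finset.Icc (1 : ℤ) N, eLpNorm (∑ j ∈ Finset.Ioc i (N : ℤ), fun ω => |D i j ω|) 2 P :=
        eLpNorm_sum_le (fun i _ => Finset.aestronglyMeasurable_sum _ fun j _ => mA i j) (by norm_num)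
    _ ≤ ∑ i ∈ Finset.Icc (1 : ℤ) N, ∑ j ∈ Finset.Ioc i (N : ℤ), eLpNorm (fun ω => |D i j ω|) 2 P :=
        Finset.sum_le_sum fun i _ => eLpNorm_sum_le (fun j _ => mA i j) (by norm_num)
    _ ≤ ∑ i ∈ Finset.Icc (1 : ℤ) N, ∑ j ∈ Finset.Ioc i (N : ℤ), ENNReal.ofReal (ρ (i - j).natAbs) :=
        Finset.sum_le_sum fun i _ => Finset.sum_le_sum fun j hj =>
          one i j (Finset.mem_Ioc.1 hj).1
    _ = ENNReal.ofReal (∑ i ∈ Finset.Icc (1 : ℤ) N, ∑ j ∈ Finset.Ioc i (N : ℤ), ρ (i - j).natAbs) := by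
        rw [ENNReal.ofReal_sum_of_nonneg fun i _ => Finset.sum_nonneg fun j _ => hρ0 _]
        refine Finset.sum_congr rfl fun i _ => ?_
        rw [ENNReal.ofReal_sum_of_nonneg fun j _ => hρ0 _]
    _ ≤ _ := by
        apply ENNReal.ofReal_le_ofReal
        have s1 : ∑ i ∈ Finset.Icc (1 : ℤ) N, ∑ j ∈ Finset.Ioc i (N : ℤ), ρ (i - j).natAbs ≤
            ∑ i ∈ Finset.Icc (1 : ℤ) N, 2 * ∑ u ∈ Finset.range N, ρ u :=
          Finset.sum_le_sum fun i hi => sum_natAbs_le N _ (fun x hx => by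
            rw [Finset.mem_Ioc] at hx; rw [Finset.mem_Icc] at hi ⊢; omega) i hi ρ hρ0
        have s2 : ∑ u ∈ Finset.range N, ρ u ≤ ∑ u ∈ Finset.range (2 * l + 1 + N), ρ u :=
          Finset.sum_le_sum_of_subset_of_nonneg (Finset.range_mono (by omega)) fun m _ _ => hρ0 m
        have s3 : ∑ u ∈ Finset.range (2 * l + 1 + N), ρ u = (2 * l + 1) * (4 * M) +
            (N * (4 * r) + 2 * M * ∑ x ∈ Finset.range N, √(β (x + 1))) := by
          rw [Finset.sum_range_add]
          congr 1
          · rw [Finset.sum_congr rfl (g := fun _ => 4 * M) fun u hu => ?_]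
            · simp
            · rw [Finset.mem_range] at hu
              simp only [ρ]; rw [if_pos (by omega)]
          · rw [Finset.sum_congr rfl (g := fun x => 4 * r + 2 * M * √(β (x + 1))) fun u hu => ?_]
            · rw [Finset.sum_add_distrib, Finset.sum_const, Finset.card_range, nsmul_eq_mul,
                Finset.mul_sum]
            · simp only [ρ]; rw [if_neg (by omega), show 2 * l + 1 + u - 2 * l = u + 1 by omega]
        have s4 := sum_sqrt_beta β hβ0 hsum N
        have s5 : M * (2 * ∑ x ∈ Finset.range N, √(β (x + 1))) ≤
          M * (1 + Real.log N + ∑' k : ℕ, (k : ℝ) * β k) := mul_le_mul_of_nonneg_left s4 hM0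
        rw [Finset.sum_const, nsmul_eq_mul] at s1
        simp only [Int.card_Icc, add_sub_cancel_right, Int.toNat_natCast] at s1
        refine s1.trans ?_
        have hN : (0 : ℝ) ≤ N := by positivity
        calc (N : ℝ) * (2 * ∑ u ∈ Finset.range N, ρ u) = 2 * N * ∑ u ∈ Finset.range N, ρ u := by ring
          _ ≤ _ := mul_le_mul_of_nonneg_left (by linarith) (by positivity)

lemma final_arith (k : ℕ) (hk : 1 ≤ k) (lam lr N M R S : ℝ) (hlam : 1 ≤ lam) (h1 : lam ≤ lr)
    (h2 : lr ≤ 2 * lam) (hN : N = lam ^ 4) (hM : 0 ≤ M) (hR : 0 ≤ R) (hS : 0 ≤ S)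
    (hlog : Real.log N ≤ k) :
    2 * N * ((2 * lr + 1) * (4 * M) + N * (4 * √(R * lr ^ (-6 : ℤ))) + M * (1 + Real.log N + S)) +
      ((k : ℝ) + 1) * √(8 * N * ((2 * M) ^ 2 * (18 + 32 * S) * lr ^ 2)) * √N ≤
    (40 * M + 8 * √R + 2 * M * (2 + S) + 8 * M * √(8 * (18 + 32 * S))) * lam ^ 5 * k := by
  have hk' : (1 : ℝ) ≤ k := by exact_mod_cast hk
  have hlr : 0 < lr := by linarith
  have hlp : 0 < lam := by linarith
  have hN0 : 0 ≤ N := by rw [hN]; positivity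
  have e1 : √(R * lr ^ (-6 : ℤ)) = √R * (lr ^ 3)⁻¹ := by
    rw [Real.sqrt_mul hR]
    congr 1
    rw [show lr ^ (-6 : ℤ) = ((lr ^ 3)⁻¹) ^ 2 by
      rw [zpow_neg, inv_pow, ← pow_mul]; norm_cast]
    exact Real.sqrt_sq (by positivity)
  have e2 : √(8 * N * ((2 * M) ^ 2 * (18 + 32 * S) * lr ^ 2)) * √N =
      N * (2 * M * lr) * √(8 * (18 + 32 * S)) := by
    rw [show 8 * N * ((2 * M) ^ 2 * (18 + 32 * S) * lr ^ 2) =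
      N * ((2 * M * lr) ^ 2 * (8 * (18 + 32 * S))) by ring, Real.sqrt_mul hN0,
      Real.sqrt_mul (by positivity), Real.sqrt_sq (by positivity)]
    calc _ = (√N * √N) * (2 * M * lr) * √(8 * (18 + 32 * S)) := by ring
      _ = _ := by rw [Real.mul_self_sqrt hN0]
  rw [e1, mul_assoc ((k : ℝ) + 1), e2]
  set W := √(8 * (18 + 32 * S))
  have hW : 0 ≤ W := Real.sqrt_nonneg _
  have hQ : 0 ≤ √R := Real.sqrt_nonneg _
  have f1 : N * (lr ^ 3)⁻¹ ≤ lam := by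
    rw [hN, ← div_eq_mul_inv, div_le_iff₀ (by positivity)]
    calc lam ^ 4 = lam * lam ^ 3 := by ring
      _ ≤ lam * lr ^ 3 := by gcongr
  have a1 : (2 * lr + 1) * (4 * M) ≤ lam * k * (20 * M) := by
    have : 2 * lr + 1 ≤ 5 * (lam * k) := by nlinarith
    nlinarith
  have a2 : N * (4 * (√R * (lr ^ 3)⁻¹)) ≤ lam * k * (4 * √R) := by
    have : N * (lr ^ 3)⁻¹ ≤ lam * k := by nlinarith
    calc _ = (N * (lr ^ 3)⁻¹) * (4 * √R) := by ring
      _ ≤ _ := by gcongr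
  have a3 : M * (1 + Real.log N + S) ≤ lam * k * (M * (2 + S)) := by
    have : 1 + Real.log N + S ≤ k * (2 + S) := by nlinarith
    have h4 : k * (2 + S) ≤ lam * (k * (2 + S)) := by
      have : 0 ≤ k * (2 + S) := by positivity
      nlinarith
    calc _ ≤ M * (lam * (k * (2 + S))) := by gcongr; linarith
      _ = _ := by ring
  have a4 : ((k : ℝ) + 1) * (N * (2 * M * lr) * W) ≤ N * (lam * k * (8 * M * W)) := by
    have : ((k : ℝ) + 1) * lr ≤ (2 * k) * (2 * lam) := by gcongr; linarith
    calc _ = (((k : ℝ) + 1) * lr) * (N * (2 * M) * W) := by ring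
      _ ≤ ((2 * k) * (2 * lam)) * (N * (2 * M) * W) := by gcongr
      _ = _ := by ring
  have e5 : lam ^ 5 = N * lam := by rw [hN]; ring
  rw [e5]
  have := mul_le_mul_of_nonneg_left (add_le_add (add_le_add a1 a2) a3)
    (by positivity : 0 ≤ 2 * N)
  calc _ ≤ _ := add_le_add this a4
    _ = _ := by ring

/-- (Lemma A.3, maximal inequality.) Under Assumption 1, for any `t` at
which the variation condition holds, there is `C` with
`‖max_{n ≤ 2^k} |Σ_{1 ≤ i < j ≤ n} h₂(X_i, X_j, t)|‖_{L²} ≤ C 2^{5k/4} k` for all `k`. -/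
theorem h2_maximal_inequality
    {Ω : Type*} [MeasurableSpace Ω] (P : Measure Ω) [IsProbabilityMeasure P]
    (X Z : ℤ → Ω → ℝ) (hX : ∀ i, Measurable (X i)) (hZ : ∀ i, Measurable (Z i))
    (h : ℝ → ℝ → ℝ → ℝ) (hker : IsUQKernel h)
    (hA1 : Assumption1 P X Z)
    (t : ℝ) (hvar : ∃ L : ℝ, VariationAt (P.map (X 0)) h L t) :
    ∃ C : ℝ, ∀ k : ℕ,
      eLpNorm (fun ω =>
          ⨆ n ∈ Finset.Icc 1 (2 ^ k),
            |∑ i ∈ Finset.Icc (1 : ℤ) (n : ℤ), ∑ j ∈ Finset.Ioc i (n : ℤ),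
              h2 (P.map (X 0)) h (X i ω) (X j ω) t|) 2 P ≤
        ENNReal.ofReal (C * (2 : ℝ) ^ ((5 * (k : ℝ)) / 4) * k) := by
  obtain ⟨L0, hL0⟩ := hvar
  obtain ⟨M, hM⟩ := hker.bounded
  obtain ⟨a, φ, -, -, -, ⟨f, mf, hf⟩, hO⟩ := hA1.pned
  obtain ⟨β, hβ0, hβ, hsum⟩ := hA1.mixing
  have hs := hA1.stationary
  obtain ⟨Cδ, hCδ, hδ⟩ := pned_delta P X Z a φ hO f hf
  have hH : Measurable (fun q : ℝ × ℝ => h q.1 q.2 t) :=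
    hker.measurable.comp (measurable_fst.prodMk (measurable_snd.prodMk measurable_const))
  have hM0 : 0 ≤ M := (hker.nonneg 0 0 t).trans (hM 0 0 t)
  set L := max L0 0
  have hLp : 0 ≤ L := le_max_right _ _
  have hL : VariationAt (P.map (X 0)) h L t := fun ε hε =>
    (hL0 ε hε).trans (ENNReal.ofReal_le_ofReal
      (mul_le_mul_of_nonneg_right (le_max_left _ _) hε.le))
  set R := 8 * L + 4 * M ^ 2 * Cδ with hR
  have hR0 : 0 ≤ R := by positivity
  set S := ∑' k : ℕ, (k : ℝ) * β k with hS
  have hS0 : 0 ≤ S := tsum_nonneg fun k => mul_nonneg (by positivity) (hβ0 k)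
  refine ⟨40 * M + 8 * √R + 2 * M * (2 + S) + 8 * M * √(8 * (18 + 32 * S)), fun k => ?_⟩
  have hmu : IsProbabilityMeasure (P.map (X 0)) :=
    Measure.isProbabilityMeasure_map (hX 0).aemeasurable
  rcases Nat.eq_zero_or_pos k with rfl | hk
  · -- trivial case
    have : (fun ω => ⨆ n ∈ Finset.Icc (1 : ℤ) (2 ^ 0),
            |∑ i ∈ Finset.Icc (1 : ℤ) (n : ℤ), ∑ j ∈ Finset.Ioc i (n : ℤ),
              h2 (P.map (X 0)) h (X i ω) (X j ω) t|) = 0 := by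
      funext ω
      refine le_antisymm ?_ (Real.iSup_nonneg fun n => Real.iSup_nonneg fun _ => abs_nonneg _)
      refine Real.iSup_le (fun n => Real.iSup_le (fun hn => ?_) le_rfl) le_rfl
      have : n = 1 := by rw [Finset.mem_Icc] at hn; simp at hn; omega
      subst this
      simp
    rw [this]
    simp
  set lam : ℝ := (2 : ℝ) ^ ((k : ℝ) / 4) with hlam
  have hlam1 : 1 ≤ lam := Real.one_le_rpow (by norm_num) (by positivity)
  have hlam4 : ((2 ^ k : ℕ) : ℝ) = lam ^ 4 := by
    rw [hlam, ← Real.rpow_natCast, ← Real.rpow_mul (by norm_num)]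
    push_cast
    rw [← Real.rpow_natCast]; congr 1; ring
  have hlam5 : (2 : ℝ) ^ ((5 * (k : ℝ)) / 4) = lam ^ 5 := by
    rw [hlam, ← Real.rpow_natCast, ← Real.rpow_mul (by norm_num)]
    congr 1; push_cast; ring
  set l := ⌈lam⌉₊ with hl
  have hl1 : lam ≤ l := Nat.le_ceil lam
  have hl2 : (l : ℝ) ≤ 2 * lam := by
    have := Nat.ceil_lt_add_one (by linarith : 0 ≤ lam)
    linarith
  have hl0 : 1 ≤ l := by
    have : (1 : ℝ) ≤ l := by linarith
    exact_mod_cast this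
  have hlr : (0 : ℝ) < l := by exact_mod_cast hl0
  set N := 2 ^ k with hN
  have mV := measurable_Vap hZ l (f l) (mf l)
  set V := Vap Z l (f l) with hV
  have hnu : IsProbabilityMeasure (P.map (V 0)) :=
    Measure.isProbabilityMeasure_map (mV 0).aemeasurable
  obtain ⟨m1, b1, s1, d1⟩ := h2_props (P.map (X 0)) h t hH (fun x y => hker.nonneg x y t)
    (fun x y => hM x y t) (fun x y => hker.symm x y t)
  obtain ⟨m2, b2, s2, d2⟩ := h2_props (P.map (V 0)) h t hH (fun x y => hker.nonneg x y t)
    (fun x y => hM x y t) (fun x y => hker.symm x y t)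
  let g : ℝ → ℝ → ℝ := fun x y => h2 (P.map (V 0)) h x y t
  let D : ℤ → ℤ → Ω → ℝ := fun i j ω => h2 (P.map (X 0)) h (X i ω) (X j ω) t - g (V i ω) (V j ω)
  have mD : ∀ i j, Measurable (D i j) := fun i j =>
    (m1.comp ((hX i).prodMk (hX j))).sub (m2.comp ((mV i).prodMk (mV j)))
  have bD : ∀ i j ω, |D i j ω| ≤ 4 * M := fun i j ω =>
    (abs_sub _ _).trans (by linarith [b1 (X i ω) (X j ω), b2 (V i ω) (V j ω)])
  have Dt := D_total P D mD M hM0 bD β hβ0 hsum l (√(R * (l : ℝ) ^ (-6 : ℤ))) (by positivity)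
    (fun s i j hij => D_bound P hX hZ hs hβ hβ0 l (f l) (mf l) s i j hij ((l : ℝ) ^ (-6 : ℤ)) Cδ
      (by positivity) hCδ (hδ l hl0) h t hH (fun x y => hker.nonneg x y t)
      (fun x y => hM x y t) L hLp hL) N
  have mT := measurable_Tsum P hX hZ hs hβ hβ0 hsum l hl0 (f l) (mf l) g m2 (2 * M) b2 d2 s2
  have Tt := Mx_bound P (Tsum V g) mT N
    (√(8 * N * ((2 * M) ^ 2 * (18 + 32 * S) * (l : ℝ) ^ 2))) (by positivity)
    (fun a b hab hb =>
      Tsum_inc P hX hZ hs hβ hβ0 hsum l hl0 (f l) (mf l) g m2 (2 * M) b2 d2 s2 N a b hab hb)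
    k 0 (by omega)
  let Dab : Ω → ℝ := fun ω => ∑ i ∈ Finset.Icc (1 : ℤ) N, ∑ j ∈ Finset.Ioc i (N : ℤ), |D i j ω|
  have mDab : Measurable Dab :=
    Finset.measurable_sum _ fun i _ => Finset.measurable_sum _ fun j _ => (mD i j).abs
  have hDab0 : ∀ ω, 0 ≤ Dab ω := fun ω =>
    Finset.sum_nonneg fun _ _ => Finset.sum_nonneg fun _ _ => abs_nonneg _
  have hMx0 : ∀ ω, 0 ≤ Mx (Tsum V g) k 0 ω := fun ω =>
    (abs_nonneg _).trans (le_Mx (Tsum V g) ω k 0 0 (by positivity))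
  have pt : ∀ ω, (⨆ n ∈ Finset.Icc (1 : ℤ) (2 ^ k),
            |∑ i ∈ Finset.Icc (1 : ℤ) (n : ℤ), ∑ j ∈ Finset.Ioc i (n : ℤ),
              h2 (P.map (X 0)) h (X i ω) (X j ω) t|) ≤ Dab ω + Mx (Tsum V g) k 0 ω := by
    intro ω
    have nn : 0 ≤ Dab ω + Mx (Tsum V g) k 0 ω := add_nonneg (hDab0 ω) (hMx0 ω)
    refine Real.iSup_le (fun n => Real.iSup_le (fun hn => ?_) nn) nn
    rw [Finset.mem_Icc] at hn
    obtain ⟨m, rfl⟩ := Int.eq_ofNat_of_zero_le (by omega : 0 ≤ n)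
    have hm : m ≤ N := by rw [hN]; exact_mod_cast hn.2
    have e : ∑ i ∈ Finset.Icc (1 : ℤ) (m : ℤ), ∑ j ∈ Finset.Ioc i (m : ℤ),
        h2 (P.map (X 0)) h (X i ω) (X j ω) t =
        ∑ i ∈ Finset.Icc (1 : ℤ) (m : ℤ), ∑ j ∈ Finset.Ioc i (m : ℤ), D i j ω + Tsum V g m ω := by
      rw [← Tsum_eq, ← Finset.sum_add_distrib]
      refine Finset.sum_congr rfl fun i _ => ?_
      rw [← Finset.sum_add_distrib]
      refine Finset.sum_congr rfl fun j _ => ?_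
      simp only [D]; ring
    rw [e]
    refine (abs_add_le _ _).trans (add_le_add ?_ ?_)
    · calc _ ≤ ∑ i ∈ Finset.Icc (1 : ℤ) (m : ℤ), |∑ j ∈ Finset.Ioc i (m : ℤ), D i j ω| :=
            Finset.abs_sum_le_sum_abs _ _
        _ ≤ ∑ i ∈ Finset.Icc (1 : ℤ) (m : ℤ), ∑ j ∈ Finset.Ioc i (m : ℤ), |D i j ω| :=
            Finset.sum_le_sum fun i _ => Finset.abs_sum_le_sum_abs _ _
        _ ≤ ∑ i ∈ Finset.Icc (1 : ℤ) (m : ℤ), ∑ j ∈ Finset.Ioc i (N : ℤ), |D i j ω| :=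
            Finset.sum_le_sum fun i _ => Finset.sum_le_sum_of_subset_of_nonneg
              (Finset.Ioc_subset_Ioc_right (by exact_mod_cast hm)) fun _ _ _ => abs_nonneg _
        _ ≤ _ := Finset.sum_le_sum_of_subset_of_nonneg
              (Finset.Icc_subset_Icc_right (by exact_mod_cast hm)) fun _ _ _ =>
                Finset.sum_nonneg fun _ _ => abs_nonneg _
    · have := le_Mx (Tsum V g) ω k 0 m hm
      have e0 : Tsum V g 0 ω = 0 := by simp [Tsum]
      rwa [e0, sub_zero, zero_add] at this
  have hlog : Real.log (N : ℝ) ≤ k := by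
    rw [hN]
    push_cast
    rw [Real.log_pow]
    have := Real.log_two_lt_d9
    have hk0 : (0 : ℝ) ≤ k := by positivity
    nlinarith
  rw [hlam5]
  refine le_trans ?_ (ENNReal.ofReal_le_ofReal (final_arith k hk lam l N M R S hlam1 hl1 hl2 hlam4
    hM0 hR0 hS0 hlog))
  have hlog0 : 0 ≤ Real.log (N : ℝ) := Real.log_natCast_nonneg N
  rw [ENNReal.ofReal_add (by positivity) (by positivity)]
  calc _ ≤ eLpNorm (Dab + Mx (Tsum V g) k 0) 2 P := by
        refine eLpNorm_mono_real fun ω => ?_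
        rw [Real.norm_eq_abs, abs_of_nonneg
          (Real.iSup_nonneg fun n => Real.iSup_nonneg fun _ => abs_nonneg _)]
        exact pt ω
    _ ≤ eLpNorm Dab 2 P + eLpNorm (Mx (Tsum V g) k 0) 2 P :=
        eLpNorm_add_le mDab.aestronglyMeasurable
          (measurable_Mx _ mT k 0).aestronglyMeasurable (by norm_num)
    _ ≤ _ := by
        refine add_le_add Dt ?_
        have eN : ((N : ℕ) : ℝ) = 2 ^ k := by rw [hN]; push_cast; rfl
        rw [eN] at Tt ⊢
        exact Tt

end UQuantile
end
end
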